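/- arXiv:math/0401235 — 2 statements merged into one kernel-verified Lean document; each statement's English description precedes it below -/
import Mathlib

section
/- Let n ≥ 1, c ≥ 0 and 0 ≤ p ≤ n be integers. Then there exist elements a_0,…,a_{2n−2} of ℚ(q) and an element L of ℚ(q) such that for every integer k, F_q(n−1,n,c,p;k) = Σ_{m=0}^{2n−2} a_m q^{m k} + (−1)^k q^{(n−1)k} L. (The signed part of the q-quasi-polynomial F_q(n−1,n,c,p;k) is a single constant multiple of q^{(n−1)k}.) -/
open Finset

noncomputable def q : RatFunc ℚ := RatFunc.X

noncomputable def qb (a : ℤ) : RatFunc ℚ := (1 - q ^ a) / (1 - q)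

noncomputable def qfac (a : ℤ) (n : ℕ) : RatFunc ℚ := ∏ i ∈ Finset.range n, qb (a + i)

noncomputable def binq (n k : ℤ) : RatFunc ℚ :=
  if 0 ≤ k ∧ k ≤ n then qfac (n - k + 1) k.toNat / qfac 1 k.toNat else 0

/-- A generalized `(r,n,c)` Gelfand-Tsetlin pattern, encoded as `a : ℕ → ℕ → ℤ` with
rows `i = 1,…,r+1`, entries `a i j` for `i-1 ≤ j ≤ n+1`, and `a i j = 0` outside this
trapezoidal domain (a harmless normalization). -/
def IsPattern (r n c : ℕ) (a : ℕ → ℕ → ℤ) : Prop :=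
  (∀ i, 1 ≤ i → i ≤ r + 1 → a i (i - 1) = 0 ∧ a i (n + 1) = c) ∧
  (∀ i j, 2 ≤ i → i ≤ r + 1 → i ≤ j + 1 → j ≤ n →
    ((a i j ≤ a i (j + 1) → a i j ≤ a (i - 1) j ∧ a (i - 1) j ≤ a i (j + 1)) ∧
     (a i (j + 1) < a i j → a i (j + 1) < a (i - 1) j ∧ a (i - 1) j < a i j))) ∧
  (∀ i j, i = 0 ∨ r + 1 < i ∨ j + 1 < i ∨ n + 1 < j → a i j = 0)

/-- The norm of a pattern: the sum of all entries, omitting the first and last entry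
of each row. -/
def patNorm (r n : ℕ) (a : ℕ → ℕ → ℤ) : ℤ :=
  ∑ i ∈ Finset.Icc 1 (r + 1), ∑ j ∈ Finset.Icc i n, a i j

/-- The number of inversions: pairs `(a i j, a i (j+1))` with `a i j > a i (j+1)`, `i ≠ 1`. -/
noncomputable def invCount (r n : ℕ) (a : ℕ → ℕ → ℤ) : ℕ :=
  {ij : ℕ × ℕ | 2 ≤ ij.1 ∧ ij.1 ≤ r + 1 ∧ ij.1 ≤ ij.2 + 1 ∧ ij.2 ≤ n ∧
    a ij.1 (ij.2 + 1) < a ij.1 ij.2}.ncard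

/-- The sign of a pattern. -/
noncomputable def patSign (r n : ℕ) (a : ℕ → ℕ → ℤ) : RatFunc ℚ := (-1) ^ invCount r n a

/-- The number of odd entries among `a 1 1, …, a 1 n`. -/
noncomputable def oddTop (n : ℕ) (a : ℕ → ℕ → ℤ) : ℕ :=
  {j | 1 ≤ j ∧ j ≤ n ∧ Odd (a 1 j)}.ncard

/-- `Fq n c p k` is `F_q(n-1,n,c,p;k)`: the signed generating function of
`(n-1,n,c)`-patterns with `a n n = k` and exactly `p` odd entries in the bottom row,
divided by `q^k`. -/
noncomputable def Fq (n c p : ℕ) (k : ℤ) : RatFunc ℚ :=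
  (∑ᶠ a ∈ {a : ℕ → ℕ → ℤ | IsPattern (n - 1) n c a ∧ a n n = k ∧ oddTop n a = p},
    patSign (n - 1) n a * q ^ patNorm (n - 1) n a) / q ^ k

/-! ### Signed sums over integer intervals -/

section SignedSum

variable {M N : Type*} [AddCommGroup M] [AddCommGroup N]

/-- The sum of `f` over `[x, y)`, extended to `y < x` by `signedSum x y f = -signedSum y x f`. -/
noncomputable def signedSum (x y : ℤ) (f : ℤ → M) : M := ∑ l ∈ Ico x y, f l - ∑ l ∈ Ico y x, f l

lemma signedSum_self (x : ℤ) (f : ℤ → M) : signedSum x x f = 0 := by simp [signedSum]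

lemma signedSum_symm (x y : ℤ) (f : ℤ → M) : signedSum y x f = -signedSum x y f := by
  simp [signedSum]

lemma signedSum_succ (x y : ℤ) (f : ℤ → M) :
    signedSum x (y + 1) f = signedSum x y f + f y := by
  unfold signedSum
  rcases le_or_gt x y with h | h
  · have h1 : Ico x (y + 1) = insert y (Ico x y) := by ext; simp; omega
    have h2 : Ico (y + 1) x = ∅ := by simp; omega
    have h3 : Ico y x = ∅ := by simp; omega
    rw [h1, h2, h3, sum_insert (by simp)]
    simp [add_comm]
  · have h1 : Ico y x = insert y (Ico (y + 1) x) := by ext; simp; omega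
    have h2 : Ico x (y + 1) = ∅ := by simp; omega
    have h3 : Ico x y = ∅ := by simp; omega
    rw [h1, h2, h3, sum_insert (by simp)]
    simp

lemma signedSum_sub_telescope (x y : ℤ) (g : ℤ → M) :
    signedSum x y (fun l => g (l + 1) - g l) = g y - g x := by
  induction y using Int.inductionOn' (b := x) with
  | zero => simp [signedSum_self]
  | succ k _ ih => rw [signedSum_succ, ih]; abel
  | pred k _ ih =>
    have h := signedSum_succ x (k - 1) (fun l => g (l + 1) - g l)
    simp only [sub_add_cancel] at h
    rw [h] at ih
    rw [eq_sub_of_add_eq ih]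
    abel

lemma signedSum_add_adjacent (x y z : ℤ) (f : ℤ → M) :
    signedSum x y f + signedSum y z f = signedSum x z f := by
  induction z using Int.inductionOn' (b := y) with
  | zero => simp [signedSum_self]
  | succ k _ ih => rw [signedSum_succ, signedSum_succ, ← ih]; abel
  | pred k _ ih =>
    have h := signedSum_succ x (k - 1) f
    have h' := signedSum_succ y (k - 1) f
    simp only [sub_add_cancel] at h h'
    rw [h, h', ← add_assoc] at ih
    exact add_right_cancel ih

lemma signedSum_translate (x y s : ℤ) (f : ℤ → M) :
    signedSum (x + s) (y + s) f = signedSum x y (fun l => f (l + s)) := by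
  simp only [signedSum]
  rw [← image_add_right_Ico x y s, ← image_add_right_Ico y x s,
    sum_image fun _ _ _ _ h => add_right_cancel h, sum_image fun _ _ _ _ h => add_right_cancel h]

lemma signedSum_add (x y : ℤ) (f g : ℤ → M) :
    signedSum x y (fun l => f l + g l) = signedSum x y f + signedSum x y g := by
  simp only [signedSum, sum_add_distrib]; abel

lemma signedSum_comm (x y z w : ℤ) (f : ℤ → ℤ → M) :
    signedSum x y (fun u => signedSum z w (fun v => f u v)) =
      signedSum z w (fun v => signedSum x y (fun u => f u v)) := by
  simp only [signedSum, sum_sub_distrib]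
  rw [sum_comm, sum_comm (s := Ico x y) (t := Ico w z), sum_comm (s := Ico y x) (t := Ico z w),
    sum_comm (s := Ico y x) (t := Ico w z)]
  abel

lemma map_signedSum (φ : M →+ N) (x y : ℤ) (f : ℤ → M) :
    φ (signedSum x y f) = signedSum x y (fun l => φ (f l)) := by
  simp [signedSum]

lemma mul_signedSum {R : Type*} [CommRing R] (c : R) (x y : ℤ) (f : ℤ → R) :
    c * signedSum x y f = signedSum x y (fun l => c * f l) :=
  map_signedSum (AddMonoidHom.mulLeft c) x y f

lemma signedSum_mul {R : Type*} [CommRing R] (c : R) (x y : ℤ) (f : ℤ → R) :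
    signedSum x y f * c = signedSum x y (fun l => f l * c) :=
  map_signedSum (AddMonoidHom.mulRight c) x y f

lemma signedSum_mem {R : Type*} [Ring R] [Module R M] {ι : Type*} (V : Submodule R (ι → M))
    (x y : ℤ) (f : ι → ℤ → M) (h : ∀ v, (fun i => f i v) ∈ V) :
    (fun i => signedSum x y (f i)) ∈ V := by
  have h1 (s : Finset ℤ) : (fun i => ∑ l ∈ s, f i l) ∈ V := by
    have : (fun i => ∑ l ∈ s, f i l) = ∑ l ∈ s, fun i => f i l := by ext; simp
    rw [this]
    exact V.sum_mem fun l _ => h l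
  exact V.sub_mem (h1 _) (h1 _)

/-- The double sum of a function over a square only depends on its symmetrization. -/
lemma two_mul_signedSum_square {R : Type*} [CommRing R] (a b : ℤ) (h k : ℤ → ℤ → R)
    (c : R) (hk : ∀ u v, h u v + h v u = k u v * c) :
    2 * signedSum a b (fun u => signedSum a b (fun v => h u v)) =
      signedSum a b (fun u => signedSum a b (fun v => k u v)) * c := by
  rw [two_mul]
  nth_rewrite 2 [signedSum_comm]
  simp only [← signedSum_add, hk, signedSum_mul]

lemma two_mul_signedSum_exchange {R : Type*} [CommRing R] (x a b y : ℤ) (h : ℤ → ℤ → ℤ → R)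
    (k : ℤ → ℤ → R) (f : ℤ → R)
    (h12 : ∀ u v w, h u v w + h v u w = k u v * f w)
    (h23 : ∀ u v w, h u v w + h u w v = k v w * f u) :
    2 * (signedSum x a (fun u => signedSum a b (fun v => signedSum b y (fun w => h u v w))) +
      signedSum x b (fun u => signedSum b a (fun v => signedSum a y (fun w => h u v w)))) =
      -signedSum a b (fun u => signedSum a b (fun v => k u v)) * signedSum x y f := by
  have e1 : 2 * signedSum x a (fun u => signedSum a b (fun v => signedSum a b (fun w => h u v w)))
      = signedSum a b (fun u => signedSum a b (fun v => k u v)) * signedSum x a f := by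
    rw [mul_signedSum, mul_signedSum]
    congr 1; ext u
    exact two_mul_signedSum_square a b (h u) k (f u) (h23 u)
  have e2 (z z' : ℤ) :
      2 * signedSum a b (fun u => signedSum a b (fun v => signedSum z z' (fun w => h u v w)))
      = signedSum a b (fun u => signedSum a b (fun v => k u v)) * signedSum z z' f := by
    refine two_mul_signedSum_square a b _ k _ fun u v => ?_
    rw [← signedSum_add, mul_signedSum]
    simp only [h12]
  have s1 (g : ℤ → R) : signedSum x b g = signedSum x a g + signedSum a b g :=
    (signedSum_add_adjacent _ _ _ _).symm
  have s2 (g : ℤ → R) : signedSum a y g = signedSum a b g + signedSum b y g :=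
    (signedSum_add_adjacent _ _ _ _).symm
  have s3 (g : ℤ → R) : signedSum x y g = signedSum x a g + signedSum a b g + signedSum b y g := by
    rw [signedSum_add_adjacent, signedSum_add_adjacent]
  have s4 (z z' : ℤ) (g : ℤ → R) : signedSum z z' (fun u => - g u) = - signedSum z z' g :=
    (map_signedSum (negAddMonoidHom) z z' g).symm
  have e3 := e2 a b
  have e4 := e2 b y
  simp only [s1, s2, s3, signedSum_symm a b, signedSum_add, s4]
  linear_combination -e1 - e3 - e4

end SignedSum

/-! ### Iterated sums over rows -/

section RowSum

variable {M N : Type*} [AddCommGroup M] [Module (RatFunc ℚ) M]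
  [AddCommGroup N] [Module (RatFunc ℚ) N]

/-- The `q`-weighted sum of `G [l₁, …, lₘ]` over `l₁ ∈ [x, a₁)`, `l₂ ∈ [a₁, a₂)`, …,
`lₘ ∈ [aₘ₋₁, aₘ)`, with signed intervals. -/
noncomputable def rowSum : List ℤ → ℤ → (List ℤ → M) → M
  | [], _, G => G []
  | a :: L, x, G => signedSum x a fun l => q ^ l • rowSum L a fun L' => G (l :: L')

lemma smul_signedSum (r : RatFunc ℚ) (x y : ℤ) (f : ℤ → M) :
    r • signedSum x y f = signedSum x y (fun l => r • f l) := by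
  simp [signedSum, smul_sub, smul_sum]

lemma rowSum_add (L : List ℤ) (x : ℤ) (G H : List ℤ → M) :
    rowSum L x (fun l => G l + H l) = rowSum L x G + rowSum L x H := by
  induction L generalizing x G H with
  | nil => rfl
  | cons a L ih => simp only [rowSum, ih, smul_add, signedSum_add]

lemma map_rowSum (φ : M →ₗ[RatFunc ℚ] N) (L : List ℤ) (x : ℤ) (G : List ℤ → M) :
    φ (rowSum L x G) = rowSum L x (fun l => φ (G l)) := by
  induction L generalizing x G with
  | nil => rfl
  | cons a L ih =>
    simp only [rowSum, ← ih, ← map_smul]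
    exact map_signedSum φ.toAddMonoidHom x a _

lemma rowSum_mem {R ι : Type*} [Ring R] [Module R M] [SMulCommClass R (RatFunc ℚ) M]
    [SMulCommClass (RatFunc ℚ) R M] [SMul (RatFunc ℚ) R] [IsScalarTower (RatFunc ℚ) R M]
    (V : Submodule R (ι → M)) (L : List ℤ) (x : ℤ) (G : ι → List ℤ → M)
    (h : ∀ l, (fun i => G i l) ∈ V) : (fun i => rowSum L x (G i)) ∈ V := by
  induction L generalizing x G with
  | nil => exact h _
  | cons a L ih =>
    refine signedSum_mem V x a _ fun l => ?_
    exact V.smul_of_tower_mem (q ^ l) (ih a _ fun l' => h _)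

end RowSum

open Polynomial

section Exchange

/-- The symmetrization of `G` in any two adjacent arguments splits off the factor `K`, leaving
`f` evaluated at the remaining arguments. -/
def HasExchange {R : Type*} [CommRing R] (K : ℤ → ℤ → R) (G f : List ℤ → R) : Prop :=
  ∀ L₁ a b L₂, G (L₁ ++ a :: b :: L₂) + G (L₁ ++ b :: a :: L₂) = K a b * f (L₁ ++ L₂)

variable {R : Type*} [CommRing R] [Algebra (RatFunc ℚ) R]

/-- The effect of one row summation on the exchange factor. -/
noncomputable def nextKernel (K : ℤ → ℤ → R) (a b : ℤ) : R :=
  (-1 / 2 : RatFunc ℚ) •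
    signedSum a b fun u => signedSum a b fun v => q ^ u • q ^ v • K u v

lemma rowSum_mul_left (L : List ℤ) (x : ℤ) (c : R) (G : List ℤ → R) :
    rowSum L x (fun l => c * G l) = c * rowSum L x G :=
  (map_rowSum (LinearMap.mulLeft (RatFunc ℚ) c) L x G).symm

lemma eq_smul_of_two_mul {A B : R} (h : 2 * A = -B) : A = (-1 / 2 : RatFunc ℚ) • B := by
  have h2 : (2 : R) = algebraMap (RatFunc ℚ) R 2 := (map_ofNat _ 2).symm
  rw [h2, ← Algebra.smul_def] at h
  rw [neg_div, neg_smul, ← smul_neg, ← h, smul_smul]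
  norm_num

lemma HasExchange.rowSum {K : ℤ → ℤ → R} {G f : List ℤ → R} (h : HasExchange K G f)
    (x y : ℤ) (L₁ : List ℤ) (a b : ℤ) (L₂ : List ℤ) :
    rowSum (L₁ ++ a :: b :: y :: L₂) x G + rowSum (L₁ ++ b :: a :: y :: L₂) x G =
      nextKernel K a b * rowSum (L₁ ++ y :: L₂) x f := by
  induction L₁ generalizing x G f with
  | nil =>
    simp only [List.nil_append, _root_.rowSum]
    have key := two_mul_signedSum_exchange x a b y
      (fun u v w => q ^ u • q ^ v • q ^ w • _root_.rowSum L₂ y fun L' => G (u :: v :: w :: L'))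
      (fun u v => q ^ u • q ^ v • K u v)
      (fun w => q ^ w • _root_.rowSum L₂ y fun L' => f (w :: L')) ?_ ?_
    · simp only [smul_signedSum]
      rw [neg_mul] at key
      rw [eq_smul_of_two_mul key, nextKernel, smul_mul_assoc]
    · intro u v w
      rw [smul_comm (q ^ v) (q ^ u), ← smul_add, ← smul_add, ← smul_add, ← rowSum_add]
      have := fun L' => h [] u v (w :: L')
      simp only [List.nil_append] at this
      simp only [this, rowSum_mul_left, smul_mul_assoc, mul_smul_comm]
      rw [smul_comm (q ^ w) (q ^ u), smul_comm (q ^ w) (q ^ v)]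
    · intro u v w
      rw [smul_comm (q ^ w) (q ^ v), ← smul_add, ← smul_add, ← smul_add, ← rowSum_add]
      have := fun L' => h [u] v w L'
      simp only [List.cons_append, List.nil_append] at this
      simp only [this, rowSum_mul_left, smul_mul_assoc, mul_smul_comm]
  | cons d L₁ ih =>
    simp only [List.cons_append, _root_.rowSum]
    rw [← signedSum_add, mul_signedSum]
    congr 1; ext l
    rw [← smul_add, mul_smul_comm, ih (f := fun L' => f (l :: L'))
      (fun M₁ a b M₂ => by simpa using h (l :: M₁) a b M₂)]

end Exchange

/-! ### Spaces of exponential functions -/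

section Exponentials

lemma q_ne_zero : q ≠ 0 := RatFunc.X_ne_zero

lemma q_pow_eq (m : ℕ) : q ^ m = algebraMap ℚ[X] (RatFunc ℚ) (X ^ m) := by
  simp [q, RatFunc.algebraMap_X]

lemma q_pow_succ_ne_one (m : ℕ) : q ^ (m + 1) ≠ 1 := by
  rw [q_pow_eq, ← map_one (algebraMap ℚ[X] (RatFunc ℚ))]
  intro h
  have := congrArg natDegree (IsFractionRing.injective ℚ[X] (RatFunc ℚ) h)
  simp at this

lemma neg_q_pow_succ_ne_one (m : ℕ) : -q ^ (m + 1) ≠ 1 := by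
  rw [q_pow_eq, ← map_neg, ← map_one (algebraMap ℚ[X] (RatFunc ℚ))]
  intro h
  have := congrArg natDegree (IsFractionRing.injective ℚ[X] (RatFunc ℚ) h)
  simp at this

/-- The bases `1, q, …, q^(2r)` and `-q^r`. -/
def bases (r : ℕ) : Set (RatFunc ℚ) := {z | (∃ m ≤ 2 * r, z = q ^ m) ∨ z = -q ^ r}

lemma one_mem_bases (r : ℕ) : 1 ∈ bases r := Or.inl ⟨0, by simp, by simp⟩

lemma ne_zero_of_mem_bases {r : ℕ} {z : RatFunc ℚ} (h : z ∈ bases r) : z ≠ 0 := by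
  rcases h with ⟨m, _, rfl⟩ | rfl
  · exact pow_ne_zero _ q_ne_zero
  · exact neg_ne_zero.2 (pow_ne_zero _ q_ne_zero)

lemma mul_q_mem_bases {r : ℕ} {z : RatFunc ℚ} (h : z ∈ bases r) : z * q ∈ bases (r + 1) := by
  rcases h with ⟨m, hm, rfl⟩ | rfl
  · exact Or.inl ⟨m + 1, by omega, (pow_succ _ _).symm⟩
  · exact Or.inr (by rw [pow_succ, neg_mul])

lemma mul_q_ne_one {r : ℕ} {z : RatFunc ℚ} (h : z ∈ bases r) : z * q ≠ 1 := by
  rcases h with ⟨m, hm, rfl⟩ | rfl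
  · rw [← pow_succ]; exact q_pow_succ_ne_one m
  · rw [neg_mul, ← pow_succ]; exact neg_q_pow_succ_ne_one r

variable (R : Type*) [CommRing R] [Algebra (RatFunc ℚ) R]

/-- The span of the functions `k ↦ z ^ k` for `z ∈ bases r`. -/
def expSpace (r : ℕ) : Submodule R (ℤ → R) :=
  Submodule.span R ((fun z k => algebraMap (RatFunc ℚ) R (z ^ k)) '' bases r)

/-- The span of the functions `(a, b) ↦ z ^ a * w ^ b` for `z, w ∈ bases r` with
`z * w = q^(2r)`. -/
def kernelSpace (r : ℕ) : Submodule R (ℤ → ℤ → R) :=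
  Submodule.span R {K | ∃ z ∈ bases r, ∃ w ∈ bases r, z * w = q ^ (2 * r) ∧
    K = fun a b => algebraMap (RatFunc ℚ) R (z ^ a * w ^ b)}

variable {R}

lemma exp_mem_expSpace {r : ℕ} {z : RatFunc ℚ} (hz : z ∈ bases r) :
    (fun k : ℤ => algebraMap (RatFunc ℚ) R (z ^ k)) ∈ expSpace R r :=
  Submodule.subset_span ⟨z, hz, rfl⟩

lemma exp_mem_kernelSpace {r : ℕ} {z w : RatFunc ℚ} (hz : z ∈ bases r) (hw : w ∈ bases r)
    (h : z * w = q ^ (2 * r)) :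
    (fun a b : ℤ => algebraMap (RatFunc ℚ) R (z ^ a * w ^ b)) ∈ kernelSpace R r :=
  Submodule.subset_span ⟨z, hz, w, hw, h, rfl⟩

lemma signedSum_exp {r : ℕ} {z : RatFunc ℚ} (hz : z ∈ bases r) (x y : ℤ) :
    signedSum x y (fun u => q ^ u • algebraMap (RatFunc ℚ) R (z ^ u)) =
      algebraMap (RatFunc ℚ) R (((z * q) ^ y - (z * q) ^ x) / (z * q - 1)) := by
  have h0 : z * q ≠ 0 := mul_ne_zero (ne_zero_of_mem_bases hz) q_ne_zero
  have h1 : z * q - 1 ≠ 0 := sub_ne_zero.2 (mul_q_ne_one hz)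
  rw [sub_div, map_sub,
    ← signedSum_sub_telescope x y (fun k => algebraMap (RatFunc ℚ) R ((z * q) ^ k / (z * q - 1)))]
  congr 1; ext u
  rw [Algebra.smul_def, ← map_mul, ← map_sub]
  congr 1
  rw [← sub_div, zpow_add_one₀ h0, mul_zpow]
  field_simp

lemma signedSum_mem_expSpace {r : ℕ} {f : ℤ → R} (hf : f ∈ expSpace R r) (x : ℤ) :
    (fun a => signedSum x a fun u => q ^ u • f u) ∈ expSpace R (r + 1) := by
  induction hf using Submodule.span_induction with
  | mem f hf =>
    obtain ⟨z, hz, rfl⟩ := hf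
    simp only [signedSum_exp hz]
    have h1 := Submodule.smul_mem _ (algebraMap (RatFunc ℚ) R (z * q - 1)⁻¹)
      (exp_mem_expSpace (R := R) (mul_q_mem_bases hz))
    have h2 := Submodule.smul_mem _ (algebraMap (RatFunc ℚ) R ((z * q) ^ x / (z * q - 1)))
      (exp_mem_expSpace (R := R) (one_mem_bases (r + 1)))
    convert Submodule.sub_mem _ h1 h2 using 1
    ext a
    simp only [Pi.sub_apply, Pi.smul_apply, smul_eq_mul, ← map_mul, ← map_sub]
    congr 1
    simp; ring
  | zero =>
    convert (expSpace R (r + 1)).zero_mem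
    simp [signedSum]
  | add f g _ _ hf hg =>
    simp only [Pi.add_apply, smul_add, signedSum_add]
    exact Submodule.add_mem _ hf hg
  | smul c f _ hf =>
    simp only [Pi.smul_apply, smul_eq_mul, ← mul_smul_comm, ← mul_signedSum]
    exact Submodule.smul_mem _ c hf

lemma kernelSpace_right {r : ℕ} {K : ℤ → ℤ → R} (hK : K ∈ kernelSpace R r) (x : ℤ) :
    K x ∈ expSpace R r := by
  induction hK using Submodule.span_induction with
  | mem f hf =>
    obtain ⟨z, hz, w, hw, h, rfl⟩ := hf
    convert Submodule.smul_mem _ (algebraMap (RatFunc ℚ) R (z ^ x)) (exp_mem_expSpace (R := R) hw)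
    ext a
    simp
  | zero => exact Submodule.zero_mem _
  | add f g _ _ hf hg => exact Submodule.add_mem _ hf hg
  | smul c f _ hf => exact Submodule.smul_mem _ c hf

lemma nextKernel_mem {r : ℕ} {K : ℤ → ℤ → R} (hK : K ∈ kernelSpace R r) :
    nextKernel K ∈ kernelSpace R (r + 1) := by
  induction hK using Submodule.span_induction with
  | mem f hf =>
    obtain ⟨z, hz, w, hw, h, rfl⟩ := hf
    have hzq := mul_q_mem_bases hz
    have hwq := mul_q_mem_bases hw
    have h2 : z * q * (w * q) = q ^ (2 * (r + 1)) := by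
      rw [mul_mul_mul_comm, h, mul_add, pow_add]; ring
    have hq : q ^ (2 * (r + 1)) ∈ bases (r + 1) := Or.inl ⟨_, le_rfl, rfl⟩
    have h1 := one_mem_bases (r + 1)
    have e := Submodule.smul_mem _
      (algebraMap (RatFunc ℚ) R ((-1 / 2) * (z * q - 1)⁻¹ * (w * q - 1)⁻¹))
      (Submodule.sub_mem _ (Submodule.add_mem _
        (exp_mem_kernelSpace (R := R) h1 hq (one_mul _))
        (exp_mem_kernelSpace (R := R) hq h1 (mul_one _)))
        (Submodule.add_mem _ (exp_mem_kernelSpace (R := R) hzq hwq h2)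
        (exp_mem_kernelSpace (R := R) hwq hzq (by rw [mul_comm, h2]))))
    convert e using 1
    ext a b
    have s1 (u : ℤ) : signedSum a b (fun v => q ^ u • q ^ v •
        algebraMap (RatFunc ℚ) R (z ^ u * w ^ v)) = algebraMap (RatFunc ℚ) R
          (((w * q) ^ b - (w * q) ^ a) / (w * q - 1)) * q ^ u • algebraMap (RatFunc ℚ) R (z ^ u) := by
      rw [← signedSum_exp hw, signedSum_mul]
      congr 1; ext v
      simp only [Algebra.smul_def, map_mul]
      ring
    simp only [nextKernel, s1, ← mul_signedSum, signedSum_exp hz]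
    simp only [Pi.sub_apply, Pi.add_apply, Pi.smul_apply, smul_eq_mul, Algebra.smul_def,
      ← map_mul, ← map_sub, ← map_add, ← h2, mul_zpow, one_zpow]
    congr 1
    ring
  | zero =>
    convert Submodule.zero_mem _
    ext a b
    simp [nextKernel, signedSum]
  | add f g _ _ hf hg =>
    convert Submodule.add_mem _ hf hg
    ext a b
    simp only [nextKernel, Pi.add_apply, smul_add, signedSum_add]
  | smul c f _ hf =>
    convert Submodule.smul_mem _ c hf
    ext a b
    simp only [nextKernel, Pi.smul_apply, smul_eq_mul, ← mul_smul_comm, ← mul_signedSum]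

lemma rowSum_mem_expSpace {r : ℕ} {K : ℤ → ℤ → R} {G f : List ℤ → R} (h : HasExchange K G f)
    (hK : K ∈ kernelSpace R r)
    (hG : ∀ L₁ L₂, (fun a => G (L₁ ++ a :: L₂)) ∈ expSpace R r) (x y : ℤ) (L₁ L₂ : List ℤ) :
    (fun a => rowSum (L₁ ++ a :: y :: L₂) x G) ∈ expSpace R (r + 1) := by
  induction L₁ generalizing x G f with
  | nil =>
    simp only [List.nil_append, rowSum]
    set g : ℤ → ℤ → R := fun u v => rowSum L₂ y fun L' => G (u :: v :: L') with hg
    have hs (u : ℤ) (a : ℤ) : signedSum a y (fun v => q ^ v • g u v) =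
        signedSum x y (fun v => q ^ v • g u v) - signedSum x a (fun v => q ^ v • g u v) := by
      rw [← signedSum_add_adjacent x a y, add_sub_cancel_left]
    have e2 (a : ℤ) := two_mul_signedSum_square x a (fun u v => q ^ u • q ^ v • g u v)
      (fun u v => q ^ u • q ^ v • K u v) (rowSum L₂ y f) (by
        intro u v
        rw [smul_comm (q ^ v) (q ^ u), ← smul_add, ← smul_add, hg]
        simp only
        rw [← rowSum_add]
        have := fun L' => h [] u v L'
        simp only [List.nil_append] at this
        simp only [this, rowSum_mul_left, smul_mul_assoc])
    have h1 := signedSum_mem_expSpace (f := fun u => signedSum x y (fun v => q ^ v • g u v)) (by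
      refine signedSum_mem _ x y _ fun v => Submodule.smul_of_tower_mem _ (q ^ v) ?_
      exact rowSum_mem _ L₂ y _ fun l => hG [] (v :: l)) x
    have h2 := Submodule.smul_mem _ (rowSum L₂ y f) (kernelSpace_right (nextKernel_mem hK) x)
    convert Submodule.add_mem _ h1 h2 using 1
    ext a
    have e3 : signedSum x a (fun u => q ^ u • signedSum a y (fun v => q ^ v • g u v)) =
        signedSum x a (fun u => q ^ u • signedSum x y (fun v => q ^ v • g u v)) +
        -signedSum x a (fun u => signedSum x a (fun v => q ^ u • q ^ v • g u v)) := by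
      rw [← sub_eq_add_neg, eq_sub_iff_add_eq, ← signedSum_add]
      congr 1; ext u
      rw [hs, smul_sub, smul_signedSum _ x a, sub_add_cancel]
    rw [e3]
    have e4 := eq_smul_of_two_mul (A := -signedSum x a (fun u => signedSum x a
      (fun v => q ^ u • q ^ v • g u v))) (by rw [mul_neg, e2 a])
    rw [e4]
    simp only [Pi.add_apply, Pi.smul_apply, smul_eq_mul, nextKernel, mul_smul_comm, mul_comm]
  | cons d L₁ ih =>
    simp only [List.cons_append, rowSum]
    refine signedSum_mem _ x d _ fun l => Submodule.smul_of_tower_mem _ (q ^ l) ?_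
    exact ih (f := fun L' => f (l :: L')) (fun M₁ a b M₂ => by simpa using h (l :: M₁) a b M₂)
      (fun M₁ M₂ => hG (l :: M₁) M₂) d

end Exponentials

/-! ### Iterated row sums over the bottom row weight -/

section Iteration

/-- The weight recording the parity of `l` by the variable `X`. -/
noncomputable def oddWeight (l : ℤ) : (RatFunc ℚ)[X] := if Odd l then X else 1

/-- The weight of a bottom row whose `j`-th entry has been raised by `s + j`. -/
noncomputable def bottomWeight : ℤ → List ℤ → (RatFunc ℚ)[X]
  | _, [] => 1
  | s, l :: L => oddWeight (l - s) * bottomWeight (s + 1) L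

/-- The generating function of shifted patterns with right boundary `C` and `r + 1` rows. -/
noncomputable def shiftedSum (C : ℤ) : ℕ → List ℤ → (RatFunc ℚ)[X]
  | 0, L => bottomWeight 1 L
  | r + 1, L => rowSum (L ++ [C]) (r + 1) (shiftedSum C r)

/-- The exchange factor of `bottomWeight`. -/
noncomputable def bottomKernel (a b : ℤ) : (RatFunc ℚ)[X] :=
  oddWeight a * oddWeight (b - 1) + oddWeight b * oddWeight (a - 1)

lemma oddWeight_eq (l s : ℤ) : oddWeight (l - s) =
    (C (1 / 2) * (1 + X)) * algebraMap (RatFunc ℚ) _ (1 ^ l) +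
      (C ((-1) ^ s / 2) * (1 - X)) * algebraMap (RatFunc ℚ) _ ((-1) ^ l) := by
  have h2 : (C (1 / 2) : (RatFunc ℚ)[X]) * 2 = 1 := by
    rw [← C_ofNat, ← C_mul]; norm_num
  unfold oddWeight
  rcases Int.even_or_odd l with hl | hl <;> rcases Int.even_or_odd s with hs | hs
  · rw [if_neg (Int.not_odd_iff_even.2 (hl.sub hs)), hl.neg_one_zpow, hs.neg_one_zpow]
    simp only [one_zpow, map_one]
    linear_combination -h2
  · rw [if_pos (hl.sub_odd hs), hl.neg_one_zpow, hs.neg_one_zpow, neg_div, C_neg]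
    simp only [one_zpow, map_one]
    linear_combination -X * h2
  · rw [if_pos (hl.sub_even hs), hl.neg_one_zpow, hs.neg_one_zpow]
    simp only [one_zpow, map_one, map_neg]
    linear_combination -X * h2
  · rw [if_neg (Int.not_odd_iff_even.2 (hl.sub_odd hs)), hl.neg_one_zpow, hs.neg_one_zpow,
      neg_div, C_neg]
    simp only [one_zpow, map_one, map_neg]
    linear_combination -h2

lemma oddWeight_congr {l m : ℤ} (h : l % 2 = m % 2) : oddWeight l = oddWeight m := by
  simp only [oddWeight, Int.odd_iff, h]

lemma bottomWeight_add_two (s : ℤ) (L : List ℤ) :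
    bottomWeight (s + 1 + 1) L = bottomWeight s L := by
  induction L generalizing s with
  | nil => rfl
  | cons l L ih => rw [bottomWeight, bottomWeight, ih, oddWeight_congr (m := l - s) (by omega)]

lemma neg_one_mem_bases : -1 ∈ bases 0 := Or.inr (by simp)

lemma bottomKernel_mem : bottomKernel ∈ kernelSpace (RatFunc ℚ)[X] 0 := by
  have h1 := one_mem_bases 0
  have e := Submodule.add_mem _
    (Submodule.smul_mem _ (C (1 / 2) * (1 + X) ^ 2)
      (exp_mem_kernelSpace (R := (RatFunc ℚ)[X]) h1 h1 (by simp)))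
    (Submodule.smul_mem _ (C (-1 / 2) * (1 - X) ^ 2)
      (exp_mem_kernelSpace (R := (RatFunc ℚ)[X]) neg_one_mem_bases neg_one_mem_bases (by simp)))
  convert e using 1
  ext1 a; ext1 b
  have h2 : (C (1 / 2) : (RatFunc ℚ)[X]) * 2 = 1 := by
    rw [← C_ofNat, ← C_mul]; norm_num
  have ha := oddWeight_eq a 0
  have hb := oddWeight_eq b 0
  have h3 : (C (-1 / 2) : (RatFunc ℚ)[X]) = - C (1 / 2) := by rw [neg_div, C_neg]
  rw [sub_zero] at ha hb
  simp only [bottomKernel, ha, hb, oddWeight_eq _ 1, Pi.add_apply, Pi.smul_apply, smul_eq_mul,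
    map_mul, one_zpow, map_one, zpow_zero, zpow_one, h3]
  linear_combination (C (1 / 2) * (1 + X) ^ 2 - C (1 / 2) * (1 - X) ^ 2 *
    (algebraMap (RatFunc ℚ) (RatFunc ℚ)[X] ((-1) ^ a) *
      algebraMap (RatFunc ℚ) (RatFunc ℚ)[X] ((-1) ^ b))) * h2

lemma bottomWeight_exchange (s : ℤ) :
    HasExchange bottomKernel (bottomWeight s) (bottomWeight s) := by
  intro L₁ a b L₂
  induction L₁ generalizing s with
  | nil =>
    simp only [List.nil_append, bottomWeight, bottomWeight_add_two]
    have : oddWeight (a - s) * oddWeight (b - (s + 1)) + oddWeight (b - s) * oddWeight (a - (s + 1))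
        = bottomKernel a b := by
      rw [bottomKernel]
      rcases Int.even_or_odd' s with ⟨t, rfl | rfl⟩
      · congr 2 <;> exact oddWeight_congr (by omega)
      · rw [add_comm (oddWeight a * _), mul_comm (oddWeight a), mul_comm (oddWeight b)]
        congr 2 <;> exact oddWeight_congr (by omega)
    rw [← this]; ring
  | cons d L₁ ih =>
    simp only [List.cons_append, bottomWeight]
    rw [← mul_add, ih]; ring

lemma bottomWeight_mem (s : ℤ) (L₁ L₂ : List ℤ) :
    (fun a => bottomWeight s (L₁ ++ a :: L₂)) ∈ expSpace (RatFunc ℚ)[X] 0 := by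
  induction L₁ generalizing s with
  | nil =>
    convert Submodule.add_mem _
      (Submodule.smul_mem _ (bottomWeight (s + 1) L₂ * (C (1 / 2) * (1 + X)))
        (exp_mem_expSpace (R := (RatFunc ℚ)[X]) (one_mem_bases 0)))
      (Submodule.smul_mem _ (bottomWeight (s + 1) L₂ * (C ((-1) ^ s / 2) * (1 - X)))
        (exp_mem_expSpace (R := (RatFunc ℚ)[X]) neg_one_mem_bases)) using 1
    ext1 a
    simp only [List.nil_append, bottomWeight, oddWeight_eq, Pi.add_apply, Pi.smul_apply,
      smul_eq_mul]
    ring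
  | cons d L₁ ih => exact Submodule.smul_mem _ _ (ih _)

lemma shiftedSum_structure (c : ℤ) (r : ℕ) :
    ∃ K ∈ kernelSpace (RatFunc ℚ)[X] r, HasExchange K (shiftedSum c r) (shiftedSum c r) ∧
      ∀ L₁ L₂, (fun a => shiftedSum c r (L₁ ++ a :: L₂)) ∈ expSpace (RatFunc ℚ)[X] r := by
  induction r with
  | zero => exact ⟨_, bottomKernel_mem, bottomWeight_exchange 1, bottomWeight_mem 1⟩
  | succ r ih =>
    obtain ⟨K, hK, hE, hV⟩ := ih
    have hy (L : List ℤ) : ∃ y L', L ++ [c] = y :: L' := by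
      cases L with
      | nil => exact ⟨_, _, rfl⟩
      | cons y L => exact ⟨_, _, rfl⟩
    refine ⟨_, nextKernel_mem hK, fun L₁ a b L₂ => ?_, fun L₁ L₂ => ?_⟩
    · obtain ⟨y, L', h⟩ := hy L₂
      simp only [shiftedSum, List.append_assoc, List.cons_append, h]
      exact hE.rowSum _ y L₁ a b L'
    · obtain ⟨y, L', h⟩ := hy L₂
      simp only [shiftedSum, List.append_assoc, List.cons_append, h]
      exact rowSum_mem_expSpace hE hK hV _ y L₁ L'

lemma exists_coeff_of_mem_expSpace {R : Type*} [CommRing R] [Algebra (RatFunc ℚ) R] {r : ℕ}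
    {f : ℤ → R} (hf : f ∈ expSpace R r) :
    ∃ (A : ℕ → R) (L : R), ∀ k, f k =
      ∑ m ∈ range (2 * r + 1), A m * algebraMap (RatFunc ℚ) R ((q ^ m) ^ k) +
        L * algebraMap (RatFunc ℚ) R ((-q ^ r) ^ k) := by
  induction hf using Submodule.span_induction with
  | mem f hf =>
    obtain ⟨z, ⟨m, hm, rfl⟩ | rfl, rfl⟩ := hf
    · refine ⟨fun i => if i = m then 1 else 0, 0, fun k => ?_⟩
      simp [hm]
    · exact ⟨0, 1, fun k => by simp⟩
  | zero => exact ⟨0, 0, fun k => by simp⟩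
  | add f g _ _ hf hg =>
    obtain ⟨A, L, h⟩ := hf
    obtain ⟨B, L', h'⟩ := hg
    refine ⟨A + B, L + L', fun k => ?_⟩
    simp only [Pi.add_apply, h, h', add_mul, sum_add_distrib]
    abel
  | smul c f _ hf =>
    obtain ⟨A, L, h⟩ := hf
    refine ⟨fun m => c * A m, c * L, fun k => ?_⟩
    simp only [Pi.smul_apply, h, smul_eq_mul, mul_add, mul_sum, mul_assoc]

end Iteration

/-! ### Interlacing rows -/

section Interlacing

/-- The integers allowed between the neighbouring entries `x` and `y` of the row above. -/
noncomputable def between (x y : ℤ) : Finset ℤ := if x ≤ y then Icc x y else Ioo y x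

/-- The sign contributed by the neighbouring entries `x` and `y`. -/
noncomputable def pairSign (x y : ℤ) : RatFunc ℚ := if y < x then -1 else 1

lemma mem_between {x y l : ℤ} :
    l ∈ between x y ↔ (x ≤ y → x ≤ l ∧ l ≤ y) ∧ (y < x → y < l ∧ l < x) := by
  unfold between
  split_ifs with h
  · simp [h, not_lt.2 h]
  · simp [h, not_le.1 h]

lemma pairSign_smul_sum {M : Type*} [AddCommGroup M] [Module (RatFunc ℚ) M] (x y : ℤ)
    (f : ℤ → M) : pairSign x y • ∑ l ∈ between x y, f l = signedSum x (y + 1) f := by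
  unfold pairSign between signedSum
  rcases le_or_gt x y with h | h
  · have h1 : Ico (y + 1) x = ∅ := by simp; omega
    have h2 : Ico x (y + 1) = Icc x y := by ext; simp
    simp [h, not_lt.2 h, h1, h2]
  · have h2 : Ico (y + 1) x = Ioo y x := by ext; simp
    simp [h, not_le.2 h, h2]

/-- The rows interlacing with the row `x :: L`. -/
noncomputable def interlacing : ℤ → List ℤ → Finset (List ℤ)
  | _, [] => {[]}
  | x, a :: L => (between x a ×ˢ interlacing a L).image fun p => p.1 :: p.2

/-- The sign of the row `x :: L`. -/
noncomputable def rowSign : ℤ → List ℤ → RatFunc ℚ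
  | _, [] => 1
  | x, a :: L => pairSign x a * rowSign a L

/-- Add `s, s + 1, …` to the successive entries of a list. -/
def shift : ℤ → List ℤ → List ℤ
  | _, [] => []
  | s, a :: L => (a + s) :: shift (s + 1) L

lemma shift_append_singleton (s c : ℤ) (L : List ℤ) :
    shift s (L ++ [c]) = shift s L ++ [c + (s + L.length)] := by
  induction L generalizing s with
  | nil => simp [shift]
  | cons a L ih =>
    simp only [List.cons_append, shift, ih, List.length_cons]
    congr 4
    push_cast; ring

lemma length_of_mem_interlacing {x : ℤ} {L l : List ℤ} (h : l ∈ interlacing x L) :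
    l.length = L.length := by
  induction L generalizing x l with
  | nil => simp_all [interlacing]
  | cons a L ih =>
    simp only [interlacing, mem_image, mem_product, Prod.exists] at h
    obtain ⟨u, l', ⟨-, h⟩, rfl⟩ := h
    simp [ih h]

/-- The power of `q` by which unshifted and shifted row sums differ. -/
noncomputable def shiftFactor : ℤ → ℕ → RatFunc ℚ
  | _, 0 => 1
  | s, m + 1 => q ^ (-s) * shiftFactor (s + 1) m

lemma sum_interlacing {M : Type*} [AddCommGroup M] [Module (RatFunc ℚ) M] (L : List ℤ) (x s : ℤ)
    (G : List ℤ → M) :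
    rowSign x L • ∑ l ∈ interlacing x L, q ^ l.sum • G (shift s l) =
      shiftFactor s L.length • rowSum (shift (s + 1) L) (x + s) G := by
  induction L generalizing x s G with
  | nil => simp [interlacing, rowSign, shift, shiftFactor, rowSum]
  | cons a L ih =>
    rw [interlacing, sum_image (by rintro ⟨u, l⟩ - ⟨u', l'⟩ - h; simpa using h), sum_product,
      shift, rowSum, rowSign, show a + (s + 1) = a + 1 + s by ring, signedSum_translate,
      ← pairSign_smul_sum, List.length_cons, shiftFactor]
    simp only [smul_sum]
    refine sum_congr rfl fun u _ => ?_
    rw [show a + 1 + s = a + (s + 1) by ring, mul_smul (q ^ (-s)),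
      smul_comm (shiftFactor _ _) (pairSign x a), smul_comm (shiftFactor _ _) (q ^ (u + s)),
      ← ih a (s + 1) (fun L' => G ((u + s) :: L'))]
    simp only [smul_sum]
    refine sum_congr rfl fun l _ => ?_
    simp only [List.sum_cons, shift, smul_smul]
    congr 1
    have hq := q_ne_zero
    rw [zpow_add₀ hq, zpow_add₀ hq, zpow_neg]
    field_simp

/-- The entries `f s, f (s + 1), …, f (s + m - 1)`. -/
def rowList (s m : ℕ) (f : ℕ → ℤ) : List ℤ := (List.range' s m).map f

lemma rowList_succ (s m : ℕ) (f : ℕ → ℤ) : rowList s (m + 1) f = f s :: rowList (s + 1) m f := rfl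

lemma rowList_succ_last (s m : ℕ) (f : ℕ → ℤ) :
    rowList s (m + 1) f = rowList s m f ++ [f (s + m)] := by
  simp [rowList, List.range'_concat]

lemma rowList_inj {s m : ℕ} {f g : ℕ → ℤ} :
    rowList s m f = rowList s m g ↔ ∀ j ∈ Ico s (s + m), f j = g j := by
  simp [rowList, List.mem_range'_1]

lemma rowList_getD {s m : ℕ} {L : List ℤ} (h : L.length = m) :
    rowList s m (fun j => L.getD (j - s) 0) = L := by
  apply List.ext_getElem
  · simp [rowList, h]
  · intro i h1 h2
    simp [rowList, h2]

lemma sum_rowList (s m : ℕ) (f : ℕ → ℤ) : (rowList s m f).sum = ∑ j ∈ Ico s (s + m), f j := by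
  induction m generalizing s with
  | zero => simp [rowList]
  | succ m ih =>
    rw [rowList_succ, List.sum_cons, ih, sum_eq_sum_Ico_succ_bot (by omega : s < s + (m + 1)),
      show s + 1 + m = s + (m + 1) by omega]

lemma rowSign_rowList (s m : ℕ) (f : ℕ → ℤ) :
    rowSign (f s) (rowList (s + 1) m f) = ∏ j ∈ Ico s (s + m), pairSign (f j) (f (j + 1)) := by
  induction m generalizing s with
  | zero => simp [rowList, rowSign]
  | succ m ih =>
    rw [rowList_succ, rowSign, ih, prod_eq_prod_Ico_succ_bot (by omega : s < s + (m + 1))]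
    congr 3; omega

lemma rowList_mem_interlacing (s m : ℕ) (f g : ℕ → ℤ) :
    rowList s m g ∈ interlacing (f s) (rowList (s + 1) m f) ↔
      ∀ j ∈ Ico s (s + m), g j ∈ between (f j) (f (j + 1)) := by
  induction m generalizing s with
  | zero => simp [rowList, interlacing]
  | succ m ih =>
    simp only [rowList_succ, interlacing, mem_image, mem_product, Prod.exists, List.cons.injEq]
    constructor
    · rintro ⟨u, l, ⟨hu, hl⟩, rfl, rfl⟩ j hj
      rw [mem_Ico] at hj
      rcases hj.1.eq_or_lt with rfl | h
      · exact hu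
      · exact (ih _).1 hl j (mem_Ico.2 (by omega))
    · intro h
      refine ⟨_, _, ⟨h s (by simp), (ih _).2 fun j hj => h j ?_⟩, rfl, rfl⟩
      rw [mem_Ico] at hj ⊢
      omega

lemma coeff_bottomWeight_rowList (s m p : ℕ) (t : ℤ) (f : ℕ → ℤ) :
    (bottomWeight t (shift t (rowList s m f))).coeff p =
      if #{j ∈ Ico s (s + m) | Odd (f j)} = p then 1 else 0 := by
  have : bottomWeight t (shift t (rowList s m f)) = X ^ #{j ∈ Ico s (s + m) | Odd (f j)} := by
    induction m generalizing s t with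
    | zero => simp [rowList, shift, bottomWeight]
    | succ m ih =>
      rw [rowList_succ, shift, bottomWeight, ih,
        ← insert_Ico_add_one_left_eq_Ico (by omega : s < s + (m + 1)),
        filter_insert, show s + 1 + m = s + (m + 1) by omega, add_sub_cancel_right, oddWeight]
      split_ifs with h
      · rw [card_insert_of_notMem (by simp), pow_succ']
      · rw [one_mul]
  rw [this, coeff_X_pow]
  simp [eq_comm]

end Interlacing

/-! ### Recursion for patterns -/

section Patterns

lemma patSign_eq_prod (r n : ℕ) (a : ℕ → ℕ → ℤ) :
    patSign r n a =
      ∏ i ∈ Icc 2 (r + 1), ∏ j ∈ Ico (i - 1) (n + 1), pairSign (a i j) (a i (j + 1)) := by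
  have h1 : invCount r n a = ∑ i ∈ Icc 2 (r + 1), ∑ j ∈ Ico (i - 1) (n + 1),
      if a i (j + 1) < a i j then 1 else 0 := by
    have hset : {ij : ℕ × ℕ | 2 ≤ ij.1 ∧ ij.1 ≤ r + 1 ∧ ij.1 ≤ ij.2 + 1 ∧ ij.2 ≤ n ∧
        a ij.1 (ij.2 + 1) < a ij.1 ij.2} =
        ↑((Icc 2 (r + 1) ×ˢ range (n + 1)).filter fun ij =>
          ij.1 ≤ ij.2 + 1 ∧ a ij.1 (ij.2 + 1) < a ij.1 ij.2) := by
      ext ⟨i, j⟩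
      simp only [Set.mem_ofPred_eq, coe_filter, mem_product, mem_Icc, mem_range]
      constructor
      · rintro ⟨_, _, _, _, _⟩; refine ⟨⟨⟨?_, ?_⟩, ?_⟩, ?_, ?_⟩ <;> omega
      · rintro ⟨⟨⟨_, _⟩, _⟩, _, _⟩; refine ⟨?_, ?_, ?_, ?_, ?_⟩ <;> omega
    rw [invCount, hset, Set.ncard_coe_finset, card_filter, sum_product]
    refine sum_congr rfl fun i _ => ?_
    have : Ico (i - 1) (n + 1) = (range (n + 1)).filter fun j => i ≤ j + 1 := by
      ext j; simp only [mem_Ico, mem_filter, mem_range]; omega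
    rw [this, sum_filter]
    exact sum_congr rfl fun j _ => ite_and _ _ _ _
  rw [patSign, h1, ← prod_pow_eq_pow_sum]
  refine prod_congr rfl fun i _ => ?_
  rw [← prod_pow_eq_pow_sum]
  refine prod_congr rfl fun j _ => ?_
  unfold pairSign
  split_ifs <;> simp

lemma patSign_succ (r n : ℕ) (a : ℕ → ℕ → ℤ) :
    patSign (r + 1) n a = patSign r n a *
      ∏ j ∈ Ico (r + 1) (n + 1), pairSign (a (r + 2) j) (a (r + 2) (j + 1)) := by
  rw [patSign_eq_prod, patSign_eq_prod, prod_Icc_succ_top (by omega)]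
  rfl

lemma patSign_congr (r n : ℕ) {a b : ℕ → ℕ → ℤ} (h : ∀ i ≤ r + 1, a i = b i) :
    patSign r n a = patSign r n b := by
  rw [patSign_eq_prod, patSign_eq_prod]
  exact prod_congr rfl fun i hi => by rw [h i (mem_Icc.1 hi).2]

/-- The contribution of a pattern to the generating function, without the norm of its top row. -/
noncomputable def lowerWeight (r n p : ℕ) (a : ℕ → ℕ → ℤ) : RatFunc ℚ :=
  patSign r n a * q ^ (∑ i ∈ Icc 1 r, ∑ j ∈ Icc i n, a i j) * if oddTop n a = p then 1 else 0

/-- The `(r, n, c)`-patterns with top row `L`. -/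
def patternsWithTop (r n c : ℕ) (L : List ℤ) : Set (ℕ → ℕ → ℤ) :=
  {a | IsPattern r n c a ∧ rowList (r + 1) (n - r) (a (r + 1)) = L}

lemma rowList_append_boundary {r n c : ℕ} (hr : r + 1 ≤ n) {a : ℕ → ℕ → ℤ}
    (hc : a (r + 2) (n + 1) = c) :
    rowList (r + 2) (n - r) (a (r + 2)) =
      rowList (r + 2) (n - (r + 1)) (a (r + 2)) ++ [(c : ℤ)] := by
  rw [show n - r = n - (r + 1) + 1 by omega, rowList_succ_last,
    show r + 2 + (n - (r + 1)) = n + 1 by omega, hc]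

lemma rowList_lower_mem {r n c : ℕ} (hr : r + 1 ≤ n) {L : List ℤ} {a : ℕ → ℕ → ℤ}
    (ha : a ∈ patternsWithTop (r + 1) n c L) :
    rowList (r + 1) (n - r) (a (r + 1)) ∈ interlacing 0 (L ++ [(c : ℤ)]) := by
  obtain ⟨⟨hb, hi, -⟩, hL⟩ := ha
  have hb2 := hb (r + 2) (by omega) (by omega)
  rw [← hL, ← rowList_append_boundary hr hb2.2, ← hb2.1,
    show r + 2 - 1 = r + 1 by omega, rowList_mem_interlacing]
  intro j hj
  rw [mem_Ico] at hj
  exact mem_between.2 (hi (r + 2) j (by omega) (by omega) (by omega) (by omega))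

lemma lowerWeight_succ {r n c p : ℕ} (hr : r + 1 ≤ n) {L : List ℤ} {a : ℕ → ℕ → ℤ}
    (ha : a ∈ patternsWithTop (r + 1) n c L) :
    lowerWeight (r + 1) n p a = rowSign 0 (L ++ [(c : ℤ)]) *
      (q ^ (rowList (r + 1) (n - r) (a (r + 1))).sum * lowerWeight r n p a) := by
  obtain ⟨⟨hb, -, -⟩, hL⟩ := ha
  have hb2 := hb (r + 2) (by omega) (by omega)
  have hIcc : Icc (r + 1) n = Ico (r + 1) (r + 1 + (n - r)) := by
    ext; simp only [mem_Icc, mem_Ico]; omega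
  have hsign := rowSign_rowList (r + 1) (n - r) (a (r + 2))
  rw [rowList_append_boundary hr hb2.2, show r + 1 + 1 = r + 2 from rfl] at hsign
  rw [← hL, ← hb2.1, show r + 2 - 1 = r + 1 by omega, show r + 1 + 1 = r + 2 from rfl, hsign,
    sum_rowList, lowerWeight, lowerWeight, patSign_succ, sum_Icc_succ_top (by omega),
    zpow_add₀ q_ne_zero, hIcc, show r + 1 + (n - r) = n + 1 by omega]
  ring

lemma lowerWeight_update {r n p : ℕ} (a : ℕ → ℕ → ℤ) (f : ℕ → ℤ) :
    lowerWeight r n p (Function.update a (r + 2) f) = lowerWeight r n p a := by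
  have h (i : ℕ) (hi : i ≤ r + 1) : Function.update a (r + 2) f i = a i :=
    Function.update_of_ne (by omega) _ _
  unfold lowerWeight
  rw [patSign_congr r n h, oddTop, oddTop, h 1 (by omega)]
  congr 3
  exact sum_congr rfl fun i hi => by rw [h i (by rw [mem_Icc] at hi; omega)]

lemma bijOn_removeTop {r n c : ℕ} (hr : r + 1 ≤ n) {L : List ℤ} (hL : L.length = n - (r + 1)) :
    Set.BijOn (fun a => Function.update a (r + 2) 0) (patternsWithTop (r + 1) n c L)
      (⋃ l ∈ (interlacing 0 (L ++ [(c : ℤ)]) : Set (List ℤ)), patternsWithTop r n c l) := by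
  refine ⟨fun a ha => ?_, fun a ha b hb h => ?_, fun b hb => ?_⟩
  · refine Set.mem_biUnion (rowList_lower_mem hr ha) ?_
    show Function.update a (r + 2) 0 ∈ patternsWithTop r n c _
    refine ⟨?_, ?_⟩
    · obtain ⟨⟨hb, hi, h0⟩, -⟩ := ha
      have h (i : ℕ) (hi : i ≠ r + 2) : Function.update a (r + 2) 0 i = a i :=
        Function.update_of_ne hi _ _
      refine ⟨fun i h1 h2 => ?_, fun i j h2 h3 h4 h5 => ?_, fun i j hij => ?_⟩
      · rw [h i (by omega)]
        exact hb i h1 (by omega)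
      · rw [h i (by omega), h (i - 1) (by omega)]
        exact hi i j h2 (by omega) h4 h5
      · rcases eq_or_ne i (r + 2) with rfl | hne
        · simp
        · rw [h i hne]
          exact h0 i j (by omega)
    · rw [Function.update_of_ne (by omega : r + 1 ≠ r + 2)]
  · funext i
    rcases eq_or_ne i (r + 2) with rfl | hne
    · funext j
      obtain ⟨⟨ha1, -, ha2⟩, haL⟩ := ha
      obtain ⟨⟨hb1, -, hb2⟩, hbL⟩ := hb
      have ha3 := ha1 (r + 2) (by omega) (by omega)
      have hb3 := hb1 (r + 2) (by omega) (by omega)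
      have hrow := rowList_inj.1 (haL.trans hbL.symm) j
      rw [mem_Ico] at hrow
      by_cases h1 : j + 1 < r + 2 ∨ n + 1 < j
      · rw [ha2 _ _ (by omega), hb2 _ _ (by omega)]
      · rcases eq_or_ne j (r + 1) with rfl | h2
        · exact ha3.1.trans hb3.1.symm
        · rcases eq_or_ne j (n + 1) with rfl | h3
          · exact ha3.2.trans hb3.2.symm
          · exact hrow (by omega)
    · have := congrFun h i
      simpa [Function.update_of_ne hne] using this
  · obtain ⟨l, hl, ⟨hb, hi, h0⟩, hbl⟩ := Set.mem_iUnion₂.1 hb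
    set top : ℕ → ℤ := fun j => if r + 2 ≤ j then (L ++ [(c : ℤ)]).getD (j - (r + 2)) 0 else 0
      with htop
    have hlen : (L ++ [(c : ℤ)]).length = n - r := by
      rw [List.length_append, hL, List.length_singleton]; omega
    have htopL : rowList (r + 2) (n - r) top = L ++ [(c : ℤ)] := by
      rw [← rowList_getD (s := r + 2) hlen, rowList_inj]
      intro j hj
      rw [mem_Ico] at hj
      rw [htop]
      simp only
      rw [if_pos hj.1]
    have htop0 : top (r + 1) = 0 := if_neg (by omega)
    have htopc : top (n + 1) = c := by
      rw [htop]
      simp only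
      rw [if_pos (by omega), show n + 1 - (r + 2) = L.length by omega]
      simp
    have hlow (i : ℕ) (hi : i ≠ r + 2) : Function.update b (r + 2) top i = b i :=
      Function.update_of_ne hi _ _
    have hint := (rowList_mem_interlacing (r + 1) (n - r) top (b (r + 1))).1 (by
      rw [htop0, htopL, hbl]; exact hl)
    refine ⟨Function.update b (r + 2) top, ⟨⟨fun i h1 h2 => ?_, fun i j h2 h3 h4 h5 => ?_,
      fun i j hij => ?_⟩, ?_⟩, ?_⟩
    · rcases eq_or_ne i (r + 2) with rfl | hne
      · rw [Function.update_self]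
        exact ⟨htop0, htopc⟩
      · rw [hlow i hne]
        exact hb i h1 (by omega)
    · rcases eq_or_ne i (r + 2) with rfl | hne
      · rw [Function.update_self, hlow _ (by omega)]
        exact mem_between.1 (hint j (mem_Ico.2 (by omega)))
      · rw [hlow i hne, hlow (i - 1) (by omega)]
        exact hi i j h2 (by omega) h4 h5
    · rcases eq_or_ne i (r + 2) with rfl | hne
      · rw [Function.update_self, htop]
        simp only
        split_ifs with h
        · rw [List.getD_eq_default]
          omega
        · rfl
      · rw [hlow i hne]
        exact h0 i j (by omega)
    · show rowList (r + 2) (n - (r + 1)) (Function.update b (r + 2) top (r + 2)) = L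
      rw [Function.update_self]
      rw [rowList_append_boundary (a := fun _ => top) hr htopc] at htopL
      exact List.append_cancel_right htopL
    · simp only [Function.update_idem]
      rw [Function.update_eq_self_iff]
      funext j
      exact (h0 (r + 2) j (by omega)).symm

lemma patternsWithTop_zero {n c : ℕ} {L : List ℤ} (hL : L.length = n) :
    ∃ a, patternsWithTop 0 n c L = {a} := by
  set top : ℕ → ℤ := fun j => if 1 ≤ j then (L ++ [(c : ℤ)]).getD (j - 1) 0 else 0 with htop
  have htopL : rowList 1 n top = L := by
    refine Eq.trans (rowList_inj.2 ?_) (rowList_getD (s := 1) hL)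
    intro j hj
    rw [mem_Ico] at hj
    rw [htop]
    simp only
    rw [if_pos hj.1, List.getD_append _ _ _ _ (by omega)]
  have htopc : top (n + 1) = c := by
    rw [htop]
    simp only
    rw [if_pos (by omega), show n + 1 - 1 = L.length by omega]
    simp
  have htop0 (j : ℕ) (hj : j < 1 ∨ n + 1 < j) : top j = 0 := by
    rw [htop]
    simp only
    split_ifs with h
    · rw [List.getD_eq_default]
      rw [List.length_append, hL, List.length_singleton]
      omega
    · rfl
  refine ⟨fun i => if i = 1 then top else 0, Set.eq_singleton_iff_unique_mem.2
    ⟨⟨⟨fun i h1 h2 => ?_, fun i j h2 h3 => ?_, fun i j hij => ?_⟩, ?_⟩, fun a ha => ?_⟩⟩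
  · obtain rfl : i = 1 := by omega
    exact ⟨htop0 0 (by omega), htopc⟩
  · omega
  · simp only
    split_ifs with h
    · exact htop0 j (by omega)
    · rfl
  · exact htopL
  · obtain ⟨⟨hb, -, h0⟩, haL⟩ := ha
    have hb1 := hb 1 le_rfl le_rfl
    have hrow := rowList_inj.1 (haL.trans htopL.symm)
    funext i j
    rcases eq_or_ne i 1 with hi | hi
    · rw [if_pos hi, hi]
      by_cases h1 : j < 1 ∨ n + 1 < j
      · rw [htop0 j h1]
        rcases h1 with h1 | h1
        · obtain rfl : j = 0 := by omega
          exact hb1.1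
        · exact h0 _ _ (by omega)
      · rcases eq_or_ne j (n + 1) with rfl | h2
        · exact hb1.2.trans htopc.symm
        · exact hrow j (mem_Ico.2 (by omega))
    · rw [if_neg hi]
      exact h0 i j (by omega)

lemma patternsWithTop_finite {r n : ℕ} (c : ℕ) (hr : r ≤ n) {L : List ℤ}
    (hL : L.length = n - r) : (patternsWithTop r n c L).Finite := by
  induction r generalizing L with
  | zero =>
    obtain ⟨a, ha⟩ := patternsWithTop_zero (c := c) (n := n) hL
    rw [ha]
    exact Set.finite_singleton a
  | succ r ih =>
    refine Set.Finite.of_finite_image ?_ (bijOn_removeTop hr hL).injOn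
    rw [(bijOn_removeTop hr hL).image_eq]
    refine Set.Finite.biUnion (finite_toSet _) fun l hl => ih (by omega) ?_
    rw [length_of_mem_interlacing (mem_coe.1 hl), List.length_append, hL, List.length_singleton]
    omega

lemma finsum_lowerWeight_succ {r n : ℕ} (c p : ℕ) (hr : r + 1 ≤ n) {L : List ℤ}
    (hL : L.length = n - (r + 1)) :
    ∑ᶠ a ∈ patternsWithTop (r + 1) n c L, lowerWeight (r + 1) n p a =
      rowSign 0 (L ++ [(c : ℤ)]) • ∑ l ∈ interlacing 0 (L ++ [(c : ℤ)]),
        q ^ l.sum • ∑ᶠ a ∈ patternsWithTop r n c l, lowerWeight r n p a := by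
  have hlen (l : List ℤ) (hl : l ∈ interlacing 0 (L ++ [(c : ℤ)])) : l.length = n - r := by
    rw [length_of_mem_interlacing hl, List.length_append, hL, List.length_singleton]
    omega
  rw [finsum_mem_eq_of_bijOn _ (bijOn_removeTop hr hL)
    (g := fun b => rowSign 0 (L ++ [(c : ℤ)]) *
      (q ^ (rowList (r + 1) (n - r) (b (r + 1))).sum * lowerWeight r n p b)) ?_]
  · rw [finsum_mem_biUnion ?_ (finite_toSet _)
      fun l hl => patternsWithTop_finite c (by omega) (hlen l hl), finsum_mem_coe_finset, smul_sum]
    · refine sum_congr rfl fun l hl => ?_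
      rw [smul_eq_mul, smul_eq_mul, ← mul_assoc, mul_finsum_mem]
      refine finsum_mem_congr rfl fun a ha => ?_
      rw [ha.2, mul_assoc]
    · intro l _ l' _ hne
      refine Set.disjoint_left.2 fun a ha ha' => hne (ha.2.symm.trans ha'.2)
  · intro a ha
    rw [lowerWeight_update, Function.update_of_ne (by omega : r + 1 ≠ r + 2),
      lowerWeight_succ hr ha]

lemma finsum_lowerWeight_eq (r n c p : ℕ) (hr : r ≤ n) :
    ∃ κ : RatFunc ℚ, ∀ L : List ℤ, L.length = n - r →
      ∑ᶠ a ∈ patternsWithTop r n c L, lowerWeight r n p a =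
        κ * (shiftedSum (c + n + 1) r (shift (r + 1) L)).coeff p := by
  induction r with
  | zero =>
    refine ⟨1, fun L hL => ?_⟩
    obtain ⟨a, ha⟩ := patternsWithTop_zero (c := c) (n := n) hL
    have haL : a ∈ patternsWithTop 0 n c L := ha ▸ Set.mem_singleton a
    have hs : patSign 0 n a = 1 := by simp [patSign_eq_prod]
    have hodd : oddTop n a = #{j ∈ Ico 1 (1 + (n - 0)) | Odd (a 1 j)} := by
      rw [oddTop, ← Set.ncard_coe_finset]
      congr 1
      ext j
      simp only [Set.mem_ofPred_eq, coe_filter, mem_Ico]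
      rw [← and_assoc]
      refine and_congr_left fun _ => ?_
      omega
    rw [ha, finsum_mem_singleton, one_mul, shiftedSum, ← haL.2, Nat.cast_zero, zero_add, zero_add,
      coeff_bottomWeight_rowList, lowerWeight, hs, hodd]
    simp
  | succ r ih =>
    obtain ⟨κ, hκ⟩ := ih (by omega)
    refine ⟨κ * shiftFactor (r + 1) (n - r), fun L hL => ?_⟩
    have hlen : (L ++ [(c : ℤ)]).length = n - r := by
      rw [List.length_append, hL, List.length_singleton]; omega
    have h1 := sum_interlacing (L ++ [(c : ℤ)]) 0 (r + 1)
      fun l => (shiftedSum (c + n + 1) r l).coeff p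
    rw [hlen] at h1
    have h2 : shift (↑(r + 1) + 1) L ++ [(c + n + 1 : ℤ)] =
        shift (r + 1 + 1) (L ++ [(c : ℤ)]) := by
      rw [shift_append_singleton, hL, Nat.cast_sub hr]
      push_cast
      congr 2
      ring
    have h3 : ∑ l ∈ interlacing 0 (L ++ [(c : ℤ)]), q ^ l.sum •
        ∑ᶠ a ∈ patternsWithTop r n c l, lowerWeight r n p a =
        κ * ∑ l ∈ interlacing 0 (L ++ [(c : ℤ)]), q ^ l.sum •
          (shiftedSum (c + n + 1) r (shift (r + 1) l)).coeff p := by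
      rw [mul_sum]
      refine sum_congr rfl fun l hl => ?_
      rw [hκ l ((length_of_mem_interlacing hl).trans hlen), smul_eq_mul, smul_eq_mul]
      ring
    rw [finsum_lowerWeight_succ c p hr hL, h3, smul_eq_mul, mul_left_comm,
      ← smul_eq_mul (rowSign _ _), h1, shiftedSum, ← lcoeff_apply, map_rowSum, h2, smul_eq_mul,
      mul_assoc, zero_add]
    rfl

end Patterns

lemma Fq_eq (r c p : ℕ) (k : ℤ) :
    Fq (r + 1) c p k =
      ∑ᶠ a ∈ patternsWithTop r (r + 1) c [k], lowerWeight r (r + 1) p a := by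
  have hsub : r + 1 - r = 1 := by omega
  have htop (a : ℕ → ℕ → ℤ) :
      rowList (r + 1) (r + 1 - r) (a (r + 1)) = [k] ↔ a (r + 1) (r + 1) = k := by
    rw [hsub, rowList_succ]
    simp [rowList]
  rw [Fq, div_eq_iff (zpow_ne_zero _ q_ne_zero), mul_comm, mul_finsum_mem]
  simp only [finsum_mem_def]
  refine finsum_congr fun a => ?_
  by_cases h1 : a ∈ patternsWithTop r (r + 1) c [k]
  · have hk : a (r + 1) (r + 1) = k := (htop a).1 h1.2
    rw [Set.indicator_of_mem h1]
    by_cases h2 : oddTop (r + 1) a = p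
    · rw [Set.indicator_of_mem (by exact ⟨h1.1, hk, h2⟩), lowerWeight, if_pos h2,
        add_tsub_cancel_right, patNorm, sum_Icc_succ_top (by omega), Icc_self, sum_singleton, hk,
        zpow_add₀ q_ne_zero]
      ring
    · rw [Set.indicator_of_notMem fun h => h2 h.2.2, lowerWeight, if_neg h2, mul_zero, mul_zero]
  · rw [Set.indicator_of_notMem h1,
      Set.indicator_of_notMem fun h => h1 ⟨h.1, (htop a).2 h.2.1⟩]

/-- **Corollary 2.** The signed part of the `q`-quasi-polynomial `F_q(n-1,n,c,p;k)` is a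
single constant multiple of `q^{(n-1)k}`. -/
theorem statement10 (n c p : ℕ) (hn : 1 ≤ n) (hp : p ≤ n) :
    ∃ a : ℕ → RatFunc ℚ, ∃ L : RatFunc ℚ, ∀ k : ℤ,
      Fq n c p k =
        (∑ m ∈ Finset.range (2 * n - 1), a m * q ^ ((m : ℤ) * k)) +
          (-1 : RatFunc ℚ) ^ k * q ^ (((n : ℤ) - 1) * k) * L := by
  obtain ⟨r, rfl⟩ : ∃ r, n = r + 1 := ⟨n - 1, by omega⟩
  obtain ⟨κ, hκ⟩ := finsum_lowerWeight_eq r (r + 1) c p (Nat.le_succ r)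
  obtain ⟨-, -, -, hmem⟩ := shiftedSum_structure (c + ↑(r + 1) + 1) r
  obtain ⟨A, B, hAB⟩ := exists_coeff_of_mem_expSpace (hmem [] [])
  refine ⟨fun m => κ * (A m).coeff p * (q ^ m) ^ (r + 1 : ℤ),
    κ * B.coeff p * (-q ^ r) ^ (r + 1 : ℤ), fun k => ?_⟩
  have hq := q_ne_zero
  have hpow (m : ℕ) : (q ^ m) ^ (k + (r + 1)) = (q ^ m) ^ (r + 1 : ℤ) * q ^ ((m : ℤ) * k) := by
    rw [zpow_add₀ (pow_ne_zero _ hq), mul_comm, zpow_mul, zpow_natCast]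
  have hneg : (-q ^ r) ^ (k + (r + 1)) =
      (-q ^ r) ^ (r + 1 : ℤ) * ((-1) ^ k * q ^ ((r : ℤ) * k)) := by
    rw [zpow_add₀ (neg_ne_zero.2 (pow_ne_zero _ hq)), mul_comm, zpow_mul, zpow_natCast, ← mul_zpow,
      neg_one_mul]
  rw [Fq_eq, hκ [k] (by simp), shift, shift]
  have h := congrArg (fun P : (RatFunc ℚ)[X] => P.coeff p) (hAB (k + (r + 1)))
  simp only [List.nil_append, algebraMap_eq, coeff_add, finsetSum_coeff, coeff_mul_C, hpow,
    hneg] at h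
  rw [h, mul_add, mul_sum, show 2 * (r + 1) - 1 = 2 * r + 1 by omega, Nat.cast_succ,
    add_sub_cancel_right]
  congr 1
  · exact sum_congr rfl fun m _ => by ring
  · ring
end

section
/- Let n ≥ 1, c ≥ 0 and 1 ≤ p ≤ n be integers. Then F_q(n−1,n,c,p;−n) = (−1)^{n−1} q^{−3n(n−1)/2} G_{n−1,c+2,p−1} in ℚ(q). -/
open Finset

/-- A strict plane partition: entries `part i j` (row `i`, column `j`, both 0-indexed),
zero outside the shape; rows weakly decrease and columns strictly decrease on the shape. -/
structure SPP where
  part : ℕ → ℕ → ℕ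
  supp_finite : {ij : ℕ × ℕ | part ij.1 ij.2 ≠ 0}.Finite
  row_decr : ∀ i j₁ j₂, j₁ ≤ j₂ → part i j₂ ≤ part i j₁
  col_strict : ∀ i j, part (i + 1) j ≠ 0 → part (i + 1) j < part i j

/-- The norm of a strict plane partition: the sum of its parts. -/
noncomputable def sppNorm (P : SPP) : ℕ := ∑ᶠ ij : ℕ × ℕ, P.part ij.1 ij.2

/-- The length of the `i`-th row (0-indexed), i.e. the part `λ_{i+1}` of the shape. -/
noncomputable def rowLen (P : SPP) (i : ℕ) : ℕ := {j | P.part i j ≠ 0}.ncard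

/-- The number of rows of odd length. -/
noncomputable def oddRows (P : SPP) : ℕ := {i | Odd (rowLen P i)}.ncard

/-- The number of parts equal to `n`. -/
noncomputable def eqCount (P : SPP) (n : ℕ) : ℕ := {ij : ℕ × ℕ | P.part ij.1 ij.2 = n}.ncard

/-- `Gspp n c p` is `G_{n,c,p}`: the generating function of strict plane partitions with
parts in `{1,…,n}`, at most `c` columns and exactly `p` rows of odd length. -/
noncomputable def Gspp (n c p : ℕ) : RatFunc ℚ :=
  ∑ᶠ P ∈ {P : SPP | (∀ i j, P.part i j ≤ n) ∧ (∀ i j, c ≤ j → P.part i j = 0) ∧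
      oddRows P = p}, q ^ sppNorm P

/-- A decidable lower set of naturals contained in `range C` is an initial segment. -/
theorem lt_card_filter_range_iff {p : ℕ → Prop} [DecidablePred p] {C : ℕ}
    (hp : ∀ k l, k ≤ l → p l → p k) (hC : ∀ k, p k → k < C) (k : ℕ) :
    k < #{x ∈ range C | p x} ↔ p k := by
  have hex : ∃ m, ¬ p m := ⟨C, fun h => lt_irrefl _ (hC C h)⟩
  have hiff : ∀ x, p x ↔ x < Nat.find hex := by
    intro x
    constructor
    · intro hx
      by_contra! hle
      exact Nat.find_spec hex (hp _ _ hle hx)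
    · intro hx
      by_contra hn
      exact Nat.find_min hex hx hn
  have heq : ({x ∈ range C | p x} : Finset ℕ) = range (Nat.find hex) := by
    ext x
    simp only [mem_filter, mem_range, ← hiff]
    exact ⟨fun h => h.2, fun h => ⟨hC x h, h⟩⟩
  rw [heq, card_range, hiff]

/-- The number of parts that are at least `i` among the first `C` parts of row `r`. -/
def levelLen (C : ℕ) (P : SPP) (i r : ℕ) : ℕ := #{k ∈ range C | i ≤ P.part r k}

section levelLen

variable {C N : ℕ} {P : SPP}

theorem lt_levelLen_iff (hcol : ∀ i j, C ≤ j → P.part i j = 0) {i : ℕ} (hi : 1 ≤ i) (r k : ℕ) :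
    k < levelLen C P i r ↔ i ≤ P.part r k := by
  refine lt_card_filter_range_iff (p := fun k => i ≤ P.part r k)
    (fun k l hkl h => h.trans (P.row_decr r k l hkl)) (fun k h => ?_) k
  by_contra! hk
  have := hcol r k hk
  omega

theorem levelLen_anti (C : ℕ) (P : SPP) (r : ℕ) {i i' : ℕ} (h : i ≤ i') :
    levelLen C P i' r ≤ levelLen C P i r := by
  refine card_le_card fun k hk => ?_
  simp only [mem_filter] at hk ⊢
  exact ⟨hk.1, h.trans hk.2⟩

theorem levelLen_le (C : ℕ) (P : SPP) (i r : ℕ) : levelLen C P i r ≤ C :=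
  (card_filter_le _ _).trans (card_range C).le

theorem levelLen_succ_le (C : ℕ) (P : SPP) {i : ℕ} (hi : 1 ≤ i) (r : ℕ) :
    levelLen C P i (r + 1) ≤ levelLen C P (i + 1) r := by
  refine card_le_card fun k hk => ?_
  simp only [mem_filter] at hk ⊢
  have := P.col_strict r k
  exact ⟨hk.1, by omega⟩

theorem SPP.part_add_le (hpart : ∀ i j, P.part i j ≤ N) (r k : ℕ) (h : P.part r k ≠ 0) :
    P.part r k + r ≤ N := by
  induction r with
  | zero => exact hpart 0 k
  | succ r ih =>
    have h1 := P.col_strict r k h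
    have h2 := ih (by omega)
    omega

theorem levelLen_eq_zero (hpart : ∀ i j, P.part i j ≤ N) {i r : ℕ} (hi : 1 ≤ i) (h : N < i + r) :
    levelLen C P i r = 0 := by
  rw [levelLen, card_eq_zero, filter_eq_empty_iff]
  intro k _ hk
  have := P.part_add_le hpart r k (by omega)
  omega

theorem rowLen_eq_levelLen (hcol : ∀ i j, C ≤ j → P.part i j = 0) (r : ℕ) :
    rowLen P r = levelLen C P 1 r := by
  have : {k | P.part r k ≠ 0} = ((range (levelLen C P 1 r) : Finset ℕ) : Set ℕ) := by
    ext k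
    simp only [coe_range, Set.mem_Iio, Set.mem_ofPred_eq, lt_levelLen_iff hcol le_rfl]
    omega
  rw [rowLen, this, Set.ncard_coe_finset, card_range]

theorem sppNorm_eq_sum_levelLen (hpart : ∀ i j, P.part i j ≤ N)
    (hcol : ∀ i j, C ≤ j → P.part i j = 0) :
    sppNorm P = ∑ i ∈ Icc 1 N, ∑ r ∈ range (N + 1 - i), levelLen C P i r := by
  have hsub : Function.support (fun ij : ℕ × ℕ => P.part ij.1 ij.2) ⊆
      ((range (N + 1) ×ˢ range C : Finset (ℕ × ℕ)) : Set (ℕ × ℕ)) := by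
    rintro ⟨r, k⟩ h
    have h' : P.part r k ≠ 0 := h
    have h1 := P.part_add_le hpart r k h'
    have h2 : k < C := by
      by_contra! hk
      exact h' (hcol r k hk)
    simp only [coe_product, coe_range, Set.mem_prod, Set.mem_Iio]
    omega
  have hpt : ∀ r k, P.part r k = ∑ i ∈ Icc 1 N, if i ≤ P.part r k then 1 else 0 := by
    intro r k
    have : ({i ∈ Icc 1 N | i ≤ P.part r k} : Finset ℕ) = Icc 1 (P.part r k) := by
      ext i
      have := hpart r k
      simp only [mem_filter, mem_Icc]
      omega
    rw [← card_filter, this, Nat.card_Icc]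
    omega
  rw [sppNorm, finsum_eq_sum_of_support_subset _ hsub, sum_product]
  have hrow : ∀ r, ∑ k ∈ range C, P.part r k = ∑ i ∈ Icc 1 N, levelLen C P i r := by
    intro r
    rw [sum_congr rfl fun k _ => hpt r k, sum_comm]
    exact sum_congr rfl fun i _ => (card_filter _ _).symm
  rw [sum_congr rfl fun r _ => hrow r, sum_comm]
  refine sum_congr rfl fun i hi => ?_
  rw [mem_Icc] at hi
  refine (sum_subset (range_subset_range.2 (by omega)) fun r _ hr => ?_).symm
  rw [mem_range] at hr
  exact levelLen_eq_zero hpart hi.1 (by omega)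

end levelLen

/-- The generalized Gelfand-Tsetlin pattern with diagonal `a i i = -i` whose other entries are
the shifted numbers of parts `≥ i` in the rows of a strict plane partition. -/
def SPP.toPattern (n c : ℕ) (P : SPP) : ℕ → ℕ → ℤ := fun i j =>
  if i = 0 ∨ n < i ∨ j < i ∨ n + 1 < j then 0
  else if j = n + 1 then c
  else if j = i then -i
  else levelLen (c + 2) P i (n - j) - 2

section toPattern

variable (n c : ℕ) (P : SPP)

theorem SPP.toPattern_outside {i j : ℕ} (h : i = 0 ∨ n < i ∨ j < i ∨ n + 1 < j) :
    P.toPattern n c i j = 0 := if_pos h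

theorem SPP.toPattern_last {i : ℕ} (h1 : 1 ≤ i) (h2 : i ≤ n) :
    P.toPattern n c i (n + 1) = c := by
  rw [toPattern, if_neg (by omega), if_pos rfl]

theorem SPP.toPattern_diag {i : ℕ} (h1 : 1 ≤ i) (h2 : i ≤ n) :
    P.toPattern n c i i = -i := by
  rw [toPattern, if_neg (by omega), if_neg (by omega), if_pos rfl]

theorem SPP.toPattern_inside {i j : ℕ} (h1 : 1 ≤ i) (h2 : i < j) (h3 : j ≤ n) :
    P.toPattern n c i j = levelLen (c + 2) P i (n - j) - 2 := by
  rw [toPattern, if_neg (by omega), if_neg (by omega), if_neg (by omega)]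

theorem SPP.toPattern_le_succ {i j : ℕ} (h1 : 1 ≤ i) (h2 : i < j) (h3 : j ≤ n) :
    P.toPattern n c i j ≤ P.toPattern n c (i + 1) (j + 1) := by
  rw [P.toPattern_inside n c h1 h2 h3]
  rcases eq_or_lt_of_le h3 with rfl | h3
  · rw [P.toPattern_last _ c (by omega) (by omega)]
    have := levelLen_le (c + 2) P i (j - j)
    omega
  · rw [P.toPattern_inside n c (by omega) (by omega) (show j + 1 ≤ n from h3)]
    have := levelLen_succ_le (c + 2) P h1 (n - (j + 1))
    rw [show n - (j + 1) + 1 = n - j by omega] at this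
    omega

theorem SPP.toPattern_succ_le {i j : ℕ} (h1 : 1 ≤ i) (h2 : i < j) (h3 : j ≤ n) :
    P.toPattern n c (i + 1) j ≤ P.toPattern n c i j := by
  rw [P.toPattern_inside n c h1 h2 h3]
  rcases (show i + 1 ≤ j from h2).eq_or_lt with rfl | h2
  · rw [P.toPattern_diag n c (by omega) h3]
    omega
  · rw [P.toPattern_inside n c (by omega) h2 h3]
    have := levelLen_anti (c + 2) P (n - j) (show i ≤ i + 1 by omega)
    omega

theorem SPP.toPattern_le_right {i j : ℕ} (h1 : 2 ≤ i) (h2 : i ≤ j) (h3 : j ≤ n) :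
    P.toPattern n c i j ≤ P.toPattern n c i (j + 1) := by
  obtain ⟨i, rfl⟩ : ∃ k, i = k + 1 := ⟨i - 1, by omega⟩
  exact (P.toPattern_succ_le n c (by omega) h2 h3).trans
    (P.toPattern_le_succ n c (by omega) h2 h3)

theorem SPP.isPattern_toPattern (hn : 1 ≤ n) : IsPattern (n - 1) n c (P.toPattern n c) := by
  rw [IsPattern, Nat.sub_add_cancel hn]
  refine ⟨fun i h1 h2 => ⟨P.toPattern_outside n c (by omega), P.toPattern_last n c h1 h2⟩, ?_,
    fun i j h => P.toPattern_outside n c (by omega)⟩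
  intro i j h1 h2 h3 h4
  obtain ⟨i, rfl⟩ : ∃ k, i = k + 1 := ⟨i - 1, by omega⟩
  rw [Nat.add_sub_cancel]
  rcases h3.eq_or_lt with h3 | h3
  · obtain rfl : i = j := by omega
    rw [P.toPattern_diag n c (by omega) h2, P.toPattern_diag n c (by omega) h4,
      P.toPattern_outside n c (by omega)]
    push_cast
    omega
  · have e1 := P.toPattern_succ_le n c (i := i) (j := j) (by omega) (by omega) h4
    have e2 := P.toPattern_le_succ n c (i := i) (j := j) (by omega) (by omega) h4
    omega

theorem SPP.patSign_toPattern (hn : 1 ≤ n) :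
    patSign (n - 1) n (P.toPattern n c) = (-1) ^ (n - 1) := by
  have : {ij : ℕ × ℕ | 2 ≤ ij.1 ∧ ij.1 ≤ n - 1 + 1 ∧ ij.1 ≤ ij.2 + 1 ∧ ij.2 ≤ n ∧
      P.toPattern n c ij.1 (ij.2 + 1) < P.toPattern n c ij.1 ij.2} =
      (fun i : ℕ => (i, i - 1)) '' ((Icc 2 n : Finset ℕ) : Set ℕ) := by
    ext ⟨i, j⟩
    simp only [Set.mem_ofPred_eq, coe_Icc, Set.mem_image, Set.mem_Icc, Prod.mk.injEq]
    constructor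
    · rintro ⟨h1, h2, h3, h4, h5⟩
      refine ⟨i, by omega, rfl, ?_⟩
      by_contra hne
      exact absurd h5 (P.toPattern_le_right n c h1 (by omega) h4).not_gt
    · rintro ⟨k, ⟨h1, h2⟩, rfl, rfl⟩
      refine ⟨h1, by omega, by omega, by omega, ?_⟩
      rw [Nat.sub_add_cancel (by omega), P.toPattern_diag n c (by omega) h2,
        P.toPattern_outside n c (by omega)]
      omega
  rw [patSign, invCount, this, Set.ncard_image_of_injective, Set.ncard_coe_finset, Nat.card_Icc]
  · congr 1
  · intro x y h
    exact (Prod.mk.inj h).1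

theorem SPP.oddTop_toPattern (hn : 1 ≤ n) (hpart : ∀ i j, P.part i j ≤ n - 1)
    (hcol : ∀ i j, c + 2 ≤ j → P.part i j = 0) :
    oddTop n (P.toPattern n c) = oddRows P + 1 := by
  have hlt : ∀ r, Odd (rowLen P r) → r < n - 1 := by
    intro r hr
    by_contra! hle
    rw [rowLen_eq_levelLen hcol, levelLen_eq_zero hpart le_rfl (by omega)] at hr
    exact absurd hr (by decide)
  have hfin : {r | Odd (rowLen P r)}.Finite := (Set.finite_Iio (n - 1)).subset hlt
  have hset : {j | 1 ≤ j ∧ j ≤ n ∧ Odd (P.toPattern n c 1 j)} =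
      insert 1 ((fun r => n - r) '' {r | Odd (rowLen P r)}) := by
    ext j
    simp only [Set.mem_ofPred_eq, Set.mem_insert_iff, Set.mem_image]
    have hodd : ∀ r, r < n - 1 →
        (Odd (P.toPattern n c 1 (n - r)) ↔ Odd (rowLen P r)) := by
      intro r hr
      rw [P.toPattern_inside n c le_rfl (by omega) (by omega), rowLen_eq_levelLen hcol,
        show n - (n - r) = r by omega, Int.odd_sub, Int.odd_coe_nat]
      simp
    constructor
    · rintro ⟨h1, h2, h3⟩
      rcases h1.eq_or_lt with rfl | h1
      · exact Or.inl rfl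
      · refine Or.inr ⟨n - j, (hodd _ (by omega)).1 ?_, by omega⟩
        rwa [show n - (n - j) = j by omega]
    · rintro (rfl | ⟨r, hr, rfl⟩)
      · refine ⟨le_rfl, hn, ?_⟩
        rw [P.toPattern_diag n c le_rfl hn]
        decide
      · have := hlt r hr
        exact ⟨by omega, by omega, (hodd r this).2 hr⟩
  have hinj : Set.InjOn (fun r => n - r) {r | Odd (rowLen P r)} := by
    intro r hr s hs h
    have h1 := hlt r hr
    have h2 := hlt s hs
    simp only at h
    omega
  rw [oddTop, hset, Set.ncard_insert_of_notMem _ (hfin.image _), hinj.ncard_image, oddRows]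
  rintro ⟨r, hr, h⟩
  have h1 := hlt r hr
  simp only at h
  omega

theorem SPP.patNorm_toPattern (hn : 1 ≤ n) (hpart : ∀ i j, P.part i j ≤ n - 1)
    (hcol : ∀ i j, c + 2 ≤ j → P.part i j = 0) :
    patNorm (n - 1) n (P.toPattern n c) =
      -(3 * (n : ℤ) * ((n : ℤ) - 1)) / 2 - n + sppNorm P := by
  have hrow : ∀ i ∈ Icc 1 n, ∑ j ∈ Icc i n, P.toPattern n c i j =
      ((i : ℤ) - 2 * n) + ((∑ r ∈ range (n - i), levelLen (c + 2) P i r : ℕ) : ℤ) := by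
    intro i hi
    rw [mem_Icc] at hi
    have hsum : ∑ j ∈ Ioc i n, P.toPattern n c i j =
        ∑ r ∈ range (n - i), ((levelLen (c + 2) P i r : ℤ) - 2) := by
      refine sum_nbij' (fun j => n - j) (fun r => n - r) ?_ ?_ ?_ ?_ ?_
      · intro j hj
        simp only [mem_Ioc, mem_range] at hj ⊢
        omega
      · intro j hj
        simp only [mem_Ioc, mem_range] at hj ⊢
        omega
      · intro j hj
        simp only [mem_Ioc] at hj
        omega
      · intro j hj
        simp only [mem_range] at hj
        omega
      · intro j hj
        rw [mem_Ioc] at hj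
        exact P.toPattern_inside n c hi.1 hj.1 hj.2
    rw [← add_sum_Ioc_eq_sum_Icc hi.2, hsum, P.toPattern_diag n c hi.1 hi.2, sum_sub_distrib,
      sum_const, card_range, nsmul_eq_mul]
    push_cast [Nat.cast_sub hi.2]
    ring
  have hlin : ∀ m : ℕ, 2 * ∑ i ∈ Icc 1 m, ((i : ℤ) - 2 * n) = m * (m + 1) - 4 * n * m := by
    intro m
    induction m with
    | zero => simp
    | succ m ih =>
      rw [sum_Icc_succ_top (by omega), mul_add, ih]
      push_cast
      ring
  have hlast : ∑ i ∈ Icc 1 n, ∑ r ∈ range (n - i), levelLen (c + 2) P i r = sppNorm P := by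
    rw [sppNorm_eq_sum_levelLen hpart hcol, Nat.sub_add_cancel hn]
    refine (sum_subset (Icc_subset_Icc_right (by omega)) fun i hi hi' => ?_).symm
    simp only [mem_Icc] at hi hi'
    rw [show n - i = 0 by omega, range_zero, sum_empty]
  rw [patNorm, Nat.sub_add_cancel hn, sum_congr rfl hrow, sum_add_distrib, ← Nat.cast_sum, hlast]
  have h2 : -(3 * (n : ℤ) * ((n : ℤ) - 1)) = 2 * (∑ i ∈ Icc 1 n, ((i : ℤ) - 2 * n) + n) := by
    rw [mul_add, hlin n]
    ring
  rw [h2, Int.mul_ediv_cancel_left _ (by norm_num)]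
  ring

end toPattern

theorem SPP.ext_part {P Q : SPP} (h : ∀ r k, P.part r k = Q.part r k) : P = Q := by
  cases P
  cases Q
  congr
  funext r k
  exact h r k

theorem SPP.eq_of_toPattern_eq {n c : ℕ} {P Q : SPP}
    (hP : ∀ i j, P.part i j ≤ n - 1) (hP' : ∀ i j, c + 2 ≤ j → P.part i j = 0)
    (hQ : ∀ i j, Q.part i j ≤ n - 1) (hQ' : ∀ i j, c + 2 ≤ j → Q.part i j = 0)
    (h : P.toPattern n c = Q.toPattern n c) : P = Q := by
  have hlen : ∀ i r, 1 ≤ i → levelLen (c + 2) P i r = levelLen (c + 2) Q i r := by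
    intro i r hi
    by_cases hir : i + r ≤ n - 1
    · have := congrFun (congrFun h i) (n - r)
      rw [P.toPattern_inside n c hi (by omega) (by omega),
        Q.toPattern_inside n c hi (by omega) (by omega), show n - (n - r) = r by omega] at this
      omega
    · rw [levelLen_eq_zero hP hi (by omega), levelLen_eq_zero hQ hi (by omega)]
  refine SPP.ext_part fun r k => ?_
  have hiff : ∀ i, 1 ≤ i → (i ≤ P.part r k ↔ i ≤ Q.part r k) := by
    intro i hi
    rw [← lt_levelLen_iff hP' hi, ← lt_levelLen_iff hQ' hi, hlen i r hi]
  have h1 := hiff (P.part r k)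
  have h2 := hiff (Q.part r k)
  omega

section structure_of_pattern

variable {n c : ℕ} {a : ℕ → ℕ → ℤ}

theorem IsPattern.diag (hn : 1 ≤ n) (ha : IsPattern (n - 1) n c a) (hk : a n n = -n)
    {i : ℕ} (h1 : 1 ≤ i) (h2 : i ≤ n) : a i i = -i := by
  rw [IsPattern, Nat.sub_add_cancel hn] at ha
  obtain ⟨hb, hint, -⟩ := ha
  have step : ∀ i, 1 ≤ i → i + 1 ≤ n → a (i + 1) (i + 1) < 0 →
      a (i + 1) (i + 1) < a i i ∧ a i i < 0 := by
    intro i h1 h2 hlt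
    have h0 := (hb (i + 1) (by omega) h2).1
    have h := (hint (i + 1) i (by omega) h2 le_rfl (by omega)).2
    rw [Nat.add_sub_cancel] at h0 h
    rw [h0] at h
    exact h hlt
  have lower : ∀ i, 1 ≤ i → i ≤ n → a i i < 0 ∧ -(i : ℤ) ≤ a i i := by
    intro i h1 h2
    induction h2 using Nat.decreasingInduction with
    | self => omega
    | of_succ k hk ih =>
      have ih := ih (by omega)
      have := step k h1 hk ih.1
      push_cast at ih
      omega
  have upper : ∀ i, 1 ≤ i → i ≤ n → a i i ≤ -(i : ℤ) := by
    intro i h1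
    induction i, h1 using Nat.le_induction with
    | base =>
      intro h
      have := (lower 1 le_rfl h).1
      omega
    | succ k hk ih =>
      intro h
      have h3 := ih (by omega)
      have h4 := step k hk h (lower (k + 1) (by omega) h).1
      push_cast
      omega
  exact le_antisymm (upper i h1 h2) (lower i h1 h2).2

theorem IsPattern.le_right (hn : 1 ≤ n) (ha : IsPattern (n - 1) n c a) (hk : a n n = -n)
    {i : ℕ} (h1 : 2 ≤ i) (h2 : i ≤ n) : ∀ j, i ≤ j → j ≤ n → a i j ≤ a i (j + 1) := by
  have hdiag := fun {i : ℕ} => ha.diag hn hk (i := i)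
  rw [IsPattern, Nat.sub_add_cancel hn] at ha
  obtain ⟨hb, hint, -⟩ := ha
  induction h2 using Nat.decreasingInduction with
  | self =>
    intro j h3 h4
    obtain rfl : j = n := by omega
    have := (hb j hn le_rfl).2
    omega
  | of_succ k hk ih =>
    have ih := ih (by omega)
    have hinter : ∀ j, k + 1 ≤ j → j ≤ n → a (k + 1) j ≤ a k j ∧ a k j ≤ a (k + 1) (j + 1) :=
      fun j h3 h4 => (hint (k + 1) j (by omega) hk (by omega) h4).1 (ih j h3 h4)
    intro j h3 h4
    rcases h3.eq_or_lt with rfl | h3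
    · by_contra! hlt
      have e1 := hdiag (i := k) (by omega) (by omega)
      have e2 := hdiag (i := k + 1) (by omega) (by omega)
      have e3 := (hinter (k + 1) le_rfl hk).1
      have e4 := (hint k k h1 (by omega) (by omega) h4).2 hlt
      push_cast at e2
      omega
    · have e1 := (hinter j h3 h4).2
      rcases h4.eq_or_lt with rfl | h4
      · have e2 := (hb k (by omega) (by omega)).2
        have e3 := (hb (k + 1) (by omega) (by omega)).2
        omega
      · exact e1.trans (hinter (j + 1) (by omega) h4).1

theorem IsPattern.interlace (hn : 1 ≤ n) (ha : IsPattern (n - 1) n c a) (hk : a n n = -n)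
    {i j : ℕ} (h1 : 1 ≤ i) (h2 : i < j) (h3 : j ≤ n) :
    a (i + 1) j ≤ a i j ∧ a i j ≤ a (i + 1) (j + 1) :=
  (ha.2.1 (i + 1) j (by omega) (by omega) (by omega) h3).1
    (ha.le_right hn hk (by omega) (by omega) j h2 h3)

theorem IsPattern.neg_two_le (hn : 1 ≤ n) (ha : IsPattern (n - 1) n c a) (hk : a n n = -n)
    {i j : ℕ} (h1 : 1 ≤ i) (h2 : i < j) (h3 : j ≤ n) : -2 ≤ a i j := by
  have row : ∀ j, 2 ≤ j → j ≤ n → -2 ≤ a 2 j := by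
    intro j hj
    induction j, hj using Nat.le_induction with
    | base =>
      intro h
      exact (ha.diag hn hk (by omega) h).ge
    | succ j hj ih =>
      intro h
      exact (ih (by omega)).trans (ha.le_right hn hk le_rfl (by omega) j hj (by omega))
  induction i, h1 using Nat.le_induction generalizing j with
  | base => exact (row j h2 h3).trans (ha.interlace hn hk le_rfl h2 h3).1
  | succ i hi ih =>
    obtain ⟨j, rfl⟩ : ∃ k, j = k + 1 := ⟨j - 1, by omega⟩
    exact (ih (by omega) (by omega)).trans
      (ha.interlace hn hk hi (by omega) (by omega)).2

theorem IsPattern.le_last (hn : 1 ≤ n) (ha : IsPattern (n - 1) n c a) (hk : a n n = -n)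
    {i j : ℕ} (h1 : 1 ≤ i) (h2 : i < j) (h3 : j ≤ n) : a i j ≤ c := by
  induction h3 using Nat.decreasingInduction generalizing i with
  | self =>
    exact (ha.interlace hn hk h1 h2 le_rfl).2.trans (ha.1 (i + 1) (by omega) (by omega)).2.le
  | of_succ j hj ih =>
    exact (ha.interlace hn hk h1 h2 (by omega)).2.trans (ih (by omega) (by omega))

theorem IsPattern.anti_left (hn : 1 ≤ n) (ha : IsPattern (n - 1) n c a) (hk : a n n = -n)
    {i i' j : ℕ} (h1 : 1 ≤ i) (h : i ≤ i') (h2 : i' < j) (h3 : j ≤ n) : a i' j ≤ a i j := by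
  induction i', h using Nat.le_induction with
  | base => exact le_rfl
  | succ k hk' ih =>
    exact (ha.interlace hn hk (by omega) (by omega) h3).1.trans (ih (by omega))

theorem IsPattern.exists_toPattern_eq (hn : 1 ≤ n) (ha : IsPattern (n - 1) n c a)
    (hk : a n n = -n) :
    ∃ P : SPP, (∀ i j, P.part i j ≤ n - 1) ∧ (∀ i j, c + 2 ≤ j → P.part i j = 0) ∧
      P.toPattern n c = a := by
  classical
  obtain ⟨f, hf⟩ : ∃ f : ℕ → ℕ → ℕ, ∀ r k i, 1 ≤ i →
      (i ≤ f r k ↔ i < n - r ∧ (k : ℤ) < a i (n - r) + 2) := by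
    refine ⟨fun r k => #{m ∈ range n | m + 1 < n - r ∧ (k : ℤ) < a (m + 1) (n - r) + 2}, ?_⟩
    intro r k i hi
    obtain ⟨i, rfl⟩ : ∃ m, i = m + 1 := ⟨i - 1, by omega⟩
    refine Nat.succ_le_iff.trans (lt_card_filter_range_iff
      (p := fun m => m + 1 < n - r ∧ (k : ℤ) < a (m + 1) (n - r) + 2) ?_ ?_ i)
    · rintro s t hst ⟨h1, h2⟩
      have := ha.anti_left hn hk (i := s + 1) (i' := t + 1) (by omega) (by omega) h1 (by omega)
      omega
    · rintro s ⟨h1, -⟩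
      omega
  have hlt : ∀ r k, f r k ≠ 0 → f r k < n - r ∧ k < c + 2 := by
    intro r k h
    have h1 := (hf r k (f r k) (by omega)).1 le_rfl
    have h2 := ha.le_last hn hk (i := f r k) (by omega) h1.1 (by omega)
    omega
  let P : SPP :=
    { part := f
      supp_finite := by
        refine ((range n ×ˢ range (c + 2) : Finset (ℕ × ℕ)).finite_toSet).subset ?_
        rintro ⟨r, k⟩ h
        have := hlt r k h
        simp only [coe_product, coe_range, Set.mem_prod, Set.mem_Iio]
        omega
      row_decr := by
        intro r k l hkl
        by_cases h0 : f r l = 0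
        · omega
        · have h1 := (hf r l (f r l) (by omega)).1 le_rfl
          exact (hf r k _ (by omega)).2 ⟨h1.1, by omega⟩
      col_strict := by
        intro r k h0
        have h1 := (hf (r + 1) k (f (r + 1) k) (by omega)).1 le_rfl
        have h2 := (ha.interlace hn hk (i := f (r + 1) k) (by omega) h1.1 (by omega)).2
        rw [show n - (r + 1) + 1 = n - r by omega] at h2
        exact (hf r k (f (r + 1) k + 1) (by omega)).2 ⟨by omega, by omega⟩ }
  have hcol : ∀ i j, c + 2 ≤ j → P.part i j = 0 := by
    intro r k hk
    by_contra h
    have := hlt r k h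
    omega
  refine ⟨P, fun r k => ?_, hcol, ?_⟩
  · by_cases h : f r k = 0
    · exact h.le.trans (Nat.zero_le _)
    · have : f r k ≤ n - 1 := by
        have := hlt r k h
        omega
      exact this
  funext i j
  have hb := ha.1
  have ho := ha.2.2
  rw [Nat.sub_add_cancel hn] at hb ho
  by_cases hout : i = 0 ∨ n < i ∨ j < i ∨ n + 1 < j
  · rw [P.toPattern_outside n c hout]
    by_cases hj : 1 ≤ i ∧ i ≤ n ∧ j = i - 1
    · rw [hj.2.2, (hb i hj.1 hj.2.1).1]
    · rw [ho i j (by omega)]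
  rcases eq_or_ne j (n + 1) with rfl | hj
  · rw [P.toPattern_last n c (by omega) (by omega), (hb i (by omega) (by omega)).2]
  rcases eq_or_ne j i with rfl | hji
  · rw [P.toPattern_diag n c (by omega) (by omega), ha.diag hn hk (by omega) (by omega)]
  have h1 : 1 ≤ i := by omega
  have h2 : i < j := by omega
  have h3 : j ≤ n := by omega
  rw [P.toPattern_inside n c h1 h2 h3]
  have hnn := ha.neg_two_le hn hk h1 h2 h3
  have hiff : ∀ k : ℕ, k < levelLen (c + 2) P i (n - j) ↔ (k : ℤ) < a i j + 2 := by
    intro k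
    rw [lt_levelLen_iff hcol h1]
    refine (hf (n - j) k i h1).trans ?_
    rw [show n - (n - j) = j by omega]
    exact and_iff_right h2
  obtain ⟨m, hm⟩ := Int.eq_ofNat_of_zero_le (show 0 ≤ a i j + 2 by omega)
  have e1 := hiff m
  have e2 := hiff (levelLen (c + 2) P i (n - j))
  omega

end structure_of_pattern

theorem SPP.bijOn_toPattern {n : ℕ} (c : ℕ) {p : ℕ} (hn : 1 ≤ n) (hp : 1 ≤ p) :
    Set.BijOn (SPP.toPattern n c)
      {P : SPP | (∀ i j, P.part i j ≤ n - 1) ∧ (∀ i j, c + 2 ≤ j → P.part i j = 0) ∧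
        oddRows P = p - 1}
      {a : ℕ → ℕ → ℤ | IsPattern (n - 1) n c a ∧ a n n = -(n : ℤ) ∧ oddTop n a = p} := by
  refine ⟨?_, ?_, ?_⟩
  · rintro P ⟨h1, h2, h3⟩
    refine ⟨P.isPattern_toPattern n c hn, P.toPattern_diag n c hn le_rfl, ?_⟩
    rw [P.oddTop_toPattern n c hn h1 h2]
    omega
  · rintro P ⟨h1, h2, -⟩ Q ⟨h3, h4, -⟩ h
    exact SPP.eq_of_toPattern_eq h1 h2 h3 h4 h
  · rintro a ⟨h1, h2, h3⟩
    obtain ⟨P, h4, h5, rfl⟩ := h1.exists_toPattern_eq hn h2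
    rw [P.oddTop_toPattern n c hn h4 h5] at h3
    exact ⟨P, ⟨h4, h5, by omega⟩, rfl⟩

/-- **Lemma (initial conditions), second identity:**
`F_q(n-1,n,c,p;-n) = (-1)^{n-1} q^{-3n(n-1)/2} G_{n-1,c+2,p-1}`. -/
theorem statement12 (n c p : ℕ) (hn : 1 ≤ n) (hp1 : 1 ≤ p) (hp : p ≤ n) :
    Fq n c p (-(n : ℤ)) =
      (-1 : RatFunc ℚ) ^ (n - 1) * q ^ (-(3 * (n : ℤ) * ((n : ℤ) - 1)) / 2) *
        Gspp (n - 1) (c + 2) (p - 1) := by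
  have hq : q ≠ 0 := RatFunc.X_ne_zero
  rw [Fq, Gspp, ← finsum_mem_eq_of_bijOn (SPP.toPattern n c) (SPP.bijOn_toPattern c hn hp1)
    (f := fun P => ((-1 : RatFunc ℚ) ^ (n - 1) *
      q ^ (-(3 * (n : ℤ) * ((n : ℤ) - 1)) / 2 - n)) * q ^ sppNorm P)]
  · simp only [← smul_eq_mul, ← smul_finsum]
    rw [zpow_sub₀ hq, zpow_neg]
    simp only [smul_eq_mul, div_inv_eq_mul]
    have hqn : q ^ (n : ℤ) ≠ 0 := zpow_ne_zero _ hq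
    field_simp
  · rintro P ⟨h1, h2, -⟩
    rw [P.patSign_toPattern n c hn, P.patNorm_toPattern n c hn h1 h2, zpow_add₀ hq,
      zpow_natCast, mul_assoc]
end
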